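/- arXiv:2301.12949 — 4 statements merged into one kernel-verified Lean document; each statement's English description precedes it below -/
import Mathlib

section
/- Let A be a unital commutative ℝ-algebra generated by a linear subspace V ⊆ A, and let p, q be Hilbertian seminorms on V with tr(p/q) < ∞. Let ε, δ > 0 and set r_ε := (δ√ε)⁻¹ √(tr(p/q)) · q. Let S be a subalgebra of A and ν_S a Radon probability measure on X(S) such that ν_S({α ∈ X(S) : |α(w)| ≥ 1}) ≤ ε for all w ∈ B_δ(p) ∩ S. Then ν_S({α ∈ X(S) : |α(v)| ≤ r_ε(v) for all v ∈ S ∩ V}) ≥ 1 − 14ε. -/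
open MeasureTheory
open scoped ENNReal

noncomputable section

/-- The character space `X(A)` of a unital commutative `ℝ`-algebra `A`:
the set of `ℝ`-algebra homomorphisms `A → ℝ`. -/
abbrev Character (A : Type*) [CommRing A] [Algebra ℝ A] := A →ₐ[ℝ] ℝ

/-- The weak topology on the character space: the weakest topology making all
evaluations `α ↦ α a` continuous. -/
instance Character.instTopologicalSpace (A : Type*) [CommRing A] [Algebra ℝ A] :
    TopologicalSpace (Character A) :=
  TopologicalSpace.induced (fun (α : Character A) (a : A) => α a) inferInstance

/-- The Borel σ-algebra on the character space. -/
instance Character.instMeasurableSpace (A : Type*) [CommRing A] [Algebra ℝ A] :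
    MeasurableSpace (Character A) :=
  borel (Character A)

/-- A Radon measure: a locally finite Borel measure that is inner regular with
respect to compact sets. -/
def IsRadonMeasure {X : Type*} [TopologicalSpace X] [MeasurableSpace X]
    (μ : Measure X) : Prop :=
  IsLocallyFiniteMeasure μ ∧ μ.InnerRegularWRT IsCompact MeasurableSet

/-- A Hilbertian seminorm on a real vector space `V`: a seminorm induced by a
symmetric positive semidefinite bilinear form, recorded by the form itself. -/
structure HilbSeminorm (V : Type*) [AddCommGroup V] [Module ℝ V] where
  bilin : V →ₗ[ℝ] V →ₗ[ℝ] ℝ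
  symm : ∀ v w, bilin v w = bilin w v
  nonneg : ∀ v, 0 ≤ bilin v v

namespace HilbSeminorm

variable {V W : Type*} [AddCommGroup V] [Module ℝ V] [AddCommGroup W] [Module ℝ W]

/-- The seminorm associated to a Hilbertian seminorm: `p v = √⟨v,v⟩ₚ`. -/
def toFun (p : HilbSeminorm V) (v : V) : ℝ := Real.sqrt (p.bilin v v)

/-- Pullback of a Hilbertian seminorm along a linear map (e.g. restriction to a
subspace along the inclusion). -/
def comp (p : HilbSeminorm V) (f : W →ₗ[ℝ] V) : HilbSeminorm W where
  bilin := LinearMap.compl₁₂ p.bilin f f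
  symm v w := by
    simp only [LinearMap.compl₁₂_apply]
    exact p.symm (f v) (f w)
  nonneg v := by
    simp only [LinearMap.compl₁₂_apply]
    exact p.nonneg (f v)

/-- The Hilbertian seminorm `c • p`, induced by the bilinear form `c² ⟨·,·⟩ₚ`. -/
def smul (p : HilbSeminorm V) (c : ℝ) : HilbSeminorm V where
  bilin := c ^ 2 • p.bilin
  symm v w := by
    simp only [LinearMap.smul_apply, smul_eq_mul]
    rw [p.symm v w]
  nonneg v := by
    simp only [LinearMap.smul_apply, smul_eq_mul]
    exact mul_nonneg (sq_nonneg c) (p.nonneg v)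

/-- A finite subset `E ⊆ V` is `q`-orthonormal. -/
def IsONS (q : HilbSeminorm V) (E : Finset V) : Prop :=
  (∀ e ∈ E, q.bilin e e = 1) ∧ ∀ e ∈ E, ∀ f ∈ E, e ≠ f → q.bilin e f = 0

open scoped Classical

/-- The trace `tr(p/q)` of a Hilbertian seminorm `p` with respect to a Hilbertian
seminorm `q`: the supremum over finite `q`-orthonormal sets `E` of `∑_{e∈E} p(e)²`
if `ker q ⊆ ker p`, and `∞` otherwise. -/
def trace (p q : HilbSeminorm V) : ℝ≥0∞ :=
  if ∀ v, q.bilin v v = 0 → p.bilin v v = 0 then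
    ⨆ (E : Finset V) (_ : q.IsONS E), ENNReal.ofReal (∑ e ∈ E, p.bilin e e)
  else ⊤

end HilbSeminorm

section AlgebraDefs

variable {A : Type*} [CommRing A] [Algebra ℝ A]

/-- The restriction `α|_V` of a character `α` is `q`-continuous. -/
def QContOn (V : Submodule ℝ A) (q : ↥V → ℝ) (α : Character A) : Prop :=
  ∃ C > 0, ∀ v : V, |α (v : A)| ≤ C * q v

/-- `J`: the family of all subalgebras of `A` generated by finite-dimensional
subspaces of `V`. -/
def finGenSubalgebras (V : Submodule ℝ A) : Set (Subalgebra ℝ A) :=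
  {S | ∃ W : Submodule ℝ A, W ≤ V ∧ FiniteDimensional ℝ ↥W ∧
    S = Algebra.adjoin ℝ (W : Set A)}

/-- The family `{ν_S : S ∈ J}` is `p`-concentrated. -/
def Concentrated (V : Submodule ℝ A) (J : Set (Subalgebra ℝ A)) (p : ↥V → ℝ)
    (ν : ∀ S : Subalgebra ℝ A, Measure (Character ↥S)) : Prop :=
  ∀ ε > (0 : ℝ), ∃ δ > (0 : ℝ), ∀ S ∈ J, ∀ v : V, ∀ hv : (v : A) ∈ S,
    p v ≤ δ → ν S {α : Character ↥S | 1 ≤ |α ⟨(v : A), hv⟩|} ≤ ENNReal.ofReal ε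

/-- A quadratic module in `A`. -/
def IsQuadraticModule (Q : Set A) : Prop :=
  (1 : A) ∈ Q ∧ (∀ x ∈ Q, ∀ y ∈ Q, x + y ∈ Q) ∧ ∀ a : A, ∀ x ∈ Q, a ^ 2 * x ∈ Q

/-- The nonnegativity set `K_Q ⊆ X(A)` of a quadratic module `Q`. -/
def charNonneg (Q : Set A) : Set (Character A) := {α | ∀ a ∈ Q, 0 ≤ α a}

/-- The nonnegativity set `K_{Q ∩ S} ⊆ X(S)` for a subalgebra `S`. -/
def charNonnegOn (Q : Set A) (S : Subalgebra ℝ A) : Set (Character ↥S) :=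
  {α | ∀ a : S, (a : A) ∈ Q → 0 ≤ α a}

/-- The Hilbertian seminorm `s_L(a) = √(L(a²))` induced by a `∑A²`-positive
linear functional `L`, via the bilinear form `(a,b) ↦ L(ab)`. -/
def sLSeminorm (L : A →ₗ[ℝ] ℝ) (hL : ∀ a : A, 0 ≤ L (a * a)) : HilbSeminorm A where
  bilin := (LinearMap.mul ℝ A).compr₂ L
  symm v w := by simp [mul_comm]
  nonneg v := by simpa using hL v

end AlgebraDefs

/-- `τ` is the topology induced by a directed family `P` of Hilbertian
seminorms. -/
def InducedByHilbFamily {V : Type*} [AddCommGroup V] [Module ℝ V]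
    (τ : TopologicalSpace V) (P : Set (HilbSeminorm V)) : Prop :=
  (∀ p ∈ P, ∀ q ∈ P, ∃ r ∈ P, ∀ v, p.toFun v ≤ r.toFun v ∧ q.toFun v ≤ r.toFun v) ∧
  ∀ v : V, (@nhds V τ v).HasBasis
    (fun pe : HilbSeminorm V × ℝ => pe.1 ∈ P ∧ 0 < pe.2)
    (fun pe => {w | pe.1.toFun (w - v) < pe.2})

/-- A topology is nuclear (in the sense of Yamasaki) if it is induced by a
directed family `P` of Hilbertian seminorms such that every `p ∈ P` admits
`q ∈ P` with `tr(p/q) < ∞`. -/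
def IsNuclearTopology {V : Type*} [AddCommGroup V] [Module ℝ V]
    (τ : TopologicalSpace V) : Prop :=
  ∃ P : Set (HilbSeminorm V), InducedByHilbFamily τ P ∧
    ∀ p ∈ P, ∃ q ∈ P, p.trace q < ⊤

end

section Gaussian

open ProbabilityTheory

/-- A centred Gaussian of variance at least one leaves `(-1, 1)` with probability at least `1/7`. -/
lemma gaussianReal_one_le_abs {v : NNReal} (hv : 1 ≤ v) :
    ENNReal.ofReal (1 / 7) ≤ gaussianReal 0 v {x | 1 ≤ |x|} := by
  have hv0 : v ≠ 0 := (zero_lt_one.trans_le hv).ne'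
  have hv' : (1 : ℝ) ≤ v := by exact_mod_cast hv
  have hIoo : gaussianReal 0 v (Set.Ioo (-1) 1) ≤ ENNReal.ofReal (6 / 7) := by
    rw [gaussianReal_apply 0 hv0]
    calc ∫⁻ x in Set.Ioo (-1 : ℝ) 1, gaussianPDF 0 v x
        ≤ ∫⁻ x in Set.Ioo (-1 : ℝ) 1, ENNReal.ofReal (3 / 7) := by
          refine lintegral_mono fun x => ENNReal.ofReal_le_ofReal ?_
          have h1 : Real.exp (-(x - 0) ^ 2 / (2 * v)) ≤ 1 := by
            rw [Real.exp_le_one_iff]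
            exact div_nonpos_of_nonpos_of_nonneg (by nlinarith [sq_nonneg (x - 0)]) (by positivity)
          have h2 : (Real.sqrt (2 * Real.pi * v))⁻¹ ≤ 3 / 7 := by
            have h3 : 7 / 3 ≤ Real.sqrt (2 * Real.pi * v) := by
              apply Real.le_sqrt_of_sq_le
              nlinarith [Real.pi_gt_three]
            calc (Real.sqrt (2 * Real.pi * v))⁻¹ ≤ (7 / 3 : ℝ)⁻¹ :=
                  inv_anti₀ (by norm_num) h3
              _ = 3 / 7 := by norm_num
          rw [gaussianPDFReal]
          calc _ ≤ (3 / 7 : ℝ) * 1 :=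
                mul_le_mul h2 h1 (Real.exp_pos _).le (by norm_num)
            _ = _ := mul_one _
      _ = ENNReal.ofReal (6 / 7) := by
          rw [setLIntegral_const, Real.volume_Ioo, ← ENNReal.ofReal_mul (by norm_num)]
          norm_num
  have hcompl : {x : ℝ | 1 ≤ |x|} = (Set.Ioo (-1) 1)ᶜ := by
    ext x
    simp only [Set.mem_ofPred_eq, Set.mem_compl_iff, Set.mem_Ioo, ← abs_lt, not_lt]
  rw [hcompl, prob_compl_eq_one_sub measurableSet_Ioo]
  calc ENNReal.ofReal (1 / 7) = 1 - ENNReal.ofReal (6 / 7) := by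
        rw [← ENNReal.ofReal_one, ← ENNReal.ofReal_sub _ (by norm_num)]
        norm_num
    _ ≤ _ := tsub_le_tsub_left hIoo 1

variable {ι : Type*} [Fintype ι]

/-- A linear form with coefficient vector of norm at least one is at least one in absolute value
with standard Gaussian probability at least `1/7`. -/
lemma stdGaussian_one_le_abs_sum (a : ι → ℝ) (ha : 1 ≤ ∑ i, a i ^ 2) :
    ENNReal.ofReal (1 / 7) ≤
      stdGaussian (EuclideanSpace ℝ ι) {g | 1 ≤ |∑ i, g i * a i|} := by
  set a' : EuclideanSpace ℝ ι := WithLp.toLp 2 a with ha'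
  have hn : ‖a'‖ ^ 2 = ∑ i, a i ^ 2 := by
    simp [EuclideanSpace.norm_sq_eq, ha']
  have hmap := IsGaussian.map_eq_gaussianReal (μ := stdGaussian (EuclideanSpace ℝ ι))
    (innerSL ℝ a')
  rw [integral_strongDual_stdGaussian, variance_dual_stdGaussian, innerSL_apply_norm, hn] at hmap
  have hset : {g : EuclideanSpace ℝ ι | 1 ≤ |∑ i, g i * a i|}
      = innerSL ℝ a' ⁻¹' {x | 1 ≤ |x|} := by
    ext g
    simp [PiLp.inner_apply, ha']
  rw [hset, ← Measure.map_apply (by fun_prop)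
    (measurableSet_le measurable_const continuous_abs.measurable), hmap]
  exact gaussianReal_one_le_abs (by rwa [Real.one_le_toNNReal])

lemma integrable_coord_mul_stdGaussian (i j : ι) :
    Integrable (fun g : EuclideanSpace ℝ ι => g i * g j) (stdGaussian (EuclideanSpace ℝ ι)) := by
  have h (i : ι) : MemLp (fun g : EuclideanSpace ℝ ι => g i) 2
      (stdGaussian (EuclideanSpace ℝ ι)) :=
    IsGaussian.memLp_dual _ (EuclideanSpace.proj i) 2 (by simp)
  exact (h i).integrable_mul (h j)

lemma integral_coord_mul_stdGaussian [DecidableEq ι] (i j : ι) :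
    ∫ g, g i * g j ∂(stdGaussian (EuclideanSpace ℝ ι)) = if i = j then 1 else 0 := by
  have hcov := covarianceBilin_apply_eq_cov (μ := stdGaussian (EuclideanSpace ℝ ι))
    IsGaussian.memLp_two_id (EuclideanSpace.single i 1) (EuclideanSpace.single j 1)
  have hmean (i : ι) : ∫ g : EuclideanSpace ℝ ι, g i ∂(stdGaussian (EuclideanSpace ℝ ι)) = 0 :=
    integral_strongDual_stdGaussian (EuclideanSpace.proj i)
  rw [covarianceBilin_stdGaussian, covariance, innerSL_apply_apply] at hcov
  simpa [hmean, EuclideanSpace.inner_single_left, Pi.single_apply] using hcov.symm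

variable {W : Type*} [AddCommGroup W] [Module ℝ W]

lemma bilin_sum_smul (B : W →ₗ[ℝ] W →ₗ[ℝ] ℝ) (u : ι → W) (g : ι → ℝ) :
    B (∑ i, g i • u i) (∑ i, g i • u i) = ∑ i, ∑ j, g i * g j * B (u i) (u j) := by
  simp only [map_sum, map_smul, LinearMap.sum_apply, LinearMap.smul_apply, smul_eq_mul,
    Finset.mul_sum]
  rw [Finset.sum_comm]
  exact Finset.sum_congr rfl fun i _ => Finset.sum_congr rfl fun j _ => by ring

lemma integrable_bilin_stdGaussian (B : W →ₗ[ℝ] W →ₗ[ℝ] ℝ) (u : ι → W) :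
    Integrable (fun g : EuclideanSpace ℝ ι => B (∑ i, g i • u i) (∑ i, g i • u i))
      (stdGaussian (EuclideanSpace ℝ ι)) := by
  simp only [bilin_sum_smul]
  exact integrable_finsetSum _ fun i _ => integrable_finsetSum _ fun j _ =>
    (integrable_coord_mul_stdGaussian i j).mul_const _

lemma integral_bilin_stdGaussian (B : W →ₗ[ℝ] W →ₗ[ℝ] ℝ) (u : ι → W) :
    ∫ g, B (∑ i, g i • u i) (∑ i, g i • u i) ∂(stdGaussian (EuclideanSpace ℝ ι))
      = ∑ i, B (u i) (u i) := by
  classical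
  simp only [bilin_sum_smul]
  rw [integral_finsetSum _ fun i _ => integrable_finsetSum _ fun j _ =>
    (integrable_coord_mul_stdGaussian i j).mul_const _]
  refine Finset.sum_congr rfl fun i _ => ?_
  rw [integral_finsetSum _ fun j _ => (integrable_coord_mul_stdGaussian i j).mul_const _]
  simp [integral_mul_const, integral_coord_mul_stdGaussian]

/-- If every `w` with `p w ≤ δ` satisfies `ν {|L w| ≥ 1} ≤ ε`, then a finite family `u` satisfies
`ν {∑ |L uᵢ|² ≥ 1} ≤ 7 (ε + ∑ p(uᵢ)² / δ²)`; proved by averaging over Gaussian combinations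
of the family. -/
lemma measure_one_le_sum_sq_le {X : Type*} [MeasurableSpace X] (ν : Measure X)
    [IsProbabilityMeasure ν] (L : X → W →ₗ[ℝ] ℝ) (hL : ∀ w, Measurable fun x => L x w)
    (p : HilbSeminorm W) {ε δ : ℝ} (hε : 0 < ε) (hδ : 0 < δ)
    (h : ∀ w, p.toFun w ≤ δ → ν {x | 1 ≤ |L x w|} ≤ ENNReal.ofReal ε) (u : ι → W) :
    ν {x | 1 ≤ ∑ i, L x (u i) ^ 2} ≤
      ENNReal.ofReal (7 * (ε + (∑ i, p.bilin (u i) (u i)) / δ ^ 2)) := by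
  set γ := stdGaussian (EuclideanSpace ℝ ι) with hγ
  set w : EuclideanSpace ℝ ι → W := fun g => ∑ i, g i • u i with hw
  have hLw (x : X) (g : EuclideanSpace ℝ ι) : L x (w g) = ∑ i, g i * L x (u i) := by
    simp [hw]
  set D : Set (X × EuclideanSpace ℝ ι) := {z | 1 ≤ |L z.1 (w z.2)|} with hD
  have hDm : MeasurableSet D := by
    refine measurableSet_le measurable_const ?_
    simp only [hLw]
    refine continuous_abs.measurable.comp (Finset.measurable_sum _ fun i _ => ?_)
    exact Measurable.mul (by fun_prop) ((hL (u i)).comp measurable_fst)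
  set G : Set (EuclideanSpace ℝ ι) := {g | δ ^ 2 ≤ p.bilin (w g) (w g)} with hG
  have hint : Integrable (fun g => p.bilin (w g) (w g)) γ := integrable_bilin_stdGaussian p.bilin u
  have hS : 0 ≤ ∑ i, p.bilin (u i) (u i) := Finset.sum_nonneg fun i _ => p.nonneg _
  have hGm : MeasurableSet G := by
    refine measurableSet_le measurable_const ?_
    simp only [hw, bilin_sum_smul]
    fun_prop
  have hGle : γ G ≤ ENNReal.ofReal ((∑ i, p.bilin (u i) (u i)) / δ ^ 2) := by
    have hM := mul_meas_ge_le_integral_of_nonneg (μ := γ)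
      (Filter.Eventually.of_forall fun g => p.nonneg (w g)) hint (δ ^ 2)
    rw [integral_bilin_stdGaussian] at hM
    rw [← ofReal_measureReal]
    refine ENNReal.ofReal_le_ofReal ?_
    rw [le_div_iff₀ (by positivity), mul_comm]
    exact hM
  have hupper : (ν.prod γ) D ≤
      ENNReal.ofReal (ε + (∑ i, p.bilin (u i) (u i)) / δ ^ 2) := by
    rw [Measure.prod_apply_symm hDm, ENNReal.ofReal_add hε.le (by positivity)]
    calc ∫⁻ g, ν ((fun x => (x, g)) ⁻¹' D) ∂γ
        ≤ ∫⁻ g, (ENNReal.ofReal ε + G.indicator 1 g) ∂γ := by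
          refine lintegral_mono fun g => ?_
          by_cases hg : g ∈ G
          · simp only [Set.indicator_of_mem hg, Pi.one_apply]
            exact prob_le_one.trans le_add_self
          · simp only [Set.indicator_of_notMem hg, add_zero]
            exact h (w g) (Real.sqrt_le_iff.2 ⟨hδ.le, (not_le.1 hg).le⟩)
      _ = ENNReal.ofReal ε + γ G := by
          rw [lintegral_add_left measurable_const, lintegral_indicator_one hGm]
          simp
      _ ≤ _ := by gcongr
  have hlower : ENNReal.ofReal (1 / 7) * ν {x | 1 ≤ ∑ i, L x (u i) ^ 2} ≤ (ν.prod γ) D := by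
    have hm : MeasurableSet {x | 1 ≤ ∑ i, L x (u i) ^ 2} :=
      measurableSet_le measurable_const
        (Finset.measurable_sum _ fun i _ => (hL (u i)).pow_const 2)
    rw [Measure.prod_apply hDm, ← setLIntegral_const]
    refine (setLIntegral_mono' hm fun x hx => ?_).trans (setLIntegral_le_lintegral _ _)
    simpa only [hD, Set.preimage_ofPred_eq, hLw] using
      stdGaussian_one_le_abs_sum (fun i => L x (u i)) hx
  calc ν {x | 1 ≤ ∑ i, L x (u i) ^ 2}
      = ENNReal.ofReal 7 * (ENNReal.ofReal (1 / 7) * ν {x | 1 ≤ ∑ i, L x (u i) ^ 2}) := by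
        rw [← mul_assoc, ← ENNReal.ofReal_mul (by norm_num)]
        norm_num
    _ ≤ ENNReal.ofReal 7 * ENNReal.ofReal (ε + (∑ i, p.bilin (u i) (u i)) / δ ^ 2) := by
        gcongr
        exact hlower.trans hupper
    _ = _ := (ENNReal.ofReal_mul (by norm_num)).symm

end Gaussian

namespace HilbSeminorm

variable {W : Type*} [AddCommGroup W] [Module ℝ W]

lemma bilin_eq_zero_of_bilin_self_eq_zero (q : HilbSeminorm W) {k : W} (hk : q.bilin k k = 0)
    (x : W) : q.bilin k x = 0 := by
  have hCS := LinearMap.BilinForm.apply_sq_le_of_symm q.bilin q.nonneg ⟨q.symm⟩ k x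
  rw [hk, zero_mul] at hCS
  exact pow_eq_zero_iff two_ne_zero |>.1 (le_antisymm hCS (sq_nonneg _))

lemma IsONS.sum_bilin_smul {q : HilbSeminorm W} {E : Finset W} (hE : q.IsONS E) (c : W → ℝ)
    {f : W} (hf : f ∈ E) : q.bilin (∑ e ∈ E, c e • e) f = c f := by
  simp only [map_sum, map_smul, LinearMap.sum_apply, LinearMap.smul_apply, smul_eq_mul]
  rw [Finset.sum_eq_single_of_mem f hf fun e he hef => by rw [hE.2 e he f hf hef, mul_zero],
    hE.1 f hf, mul_one]

lemma IsONS.bilin_residual {q : HilbSeminorm W} {E : Finset W} (hE : q.IsONS E) (v : W)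
    {f : W} (hf : f ∈ E) : q.bilin (v - ∑ e ∈ E, q.bilin v e • e) f = 0 := by
  rw [map_sub, LinearMap.sub_apply, hE.sum_bilin_smul _ hf, sub_self]

/-- Bessel's inequality. -/
lemma IsONS.sum_sq_le {q : HilbSeminorm W} {E : Finset W} (hE : q.IsONS E) (v : W) :
    ∑ e ∈ E, q.bilin v e ^ 2 ≤ q.bilin v v := by
  have h0 := q.nonneg (v - ∑ e ∈ E, q.bilin v e • e)
  have h1 : q.bilin (v - ∑ e ∈ E, q.bilin v e • e) (∑ e ∈ E, q.bilin v e • e) = 0 := by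
    rw [map_sum]
    exact Finset.sum_eq_zero fun f hf => by rw [map_smul, hE.bilin_residual v hf, smul_zero]
  rw [map_sub, h1, sub_zero, q.symm, map_sub, map_sum] at h0
  simpa [sq] using h0

/-- Gram–Schmidt for a positive semidefinite form: every finite set is contained in the span of
a finite orthonormal set up to vectors of seminorm zero. -/
lemma exists_isONS_bilin_residual_eq_zero (q : HilbSeminorm W) (s : Finset W) :
    ∃ E : Finset W, q.IsONS E ∧ ∀ v ∈ s, q.bilin (v - ∑ e ∈ E, q.bilin v e • e)
      (v - ∑ e ∈ E, q.bilin v e • e) = 0 := by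
  classical
  induction s using Finset.induction_on with
  | empty => exact ⟨∅, ⟨by simp, by simp⟩, by simp⟩
  | insert v s _ ih =>
    obtain ⟨E, hE, hs⟩ := ih
    set k := v - ∑ e ∈ E, q.bilin v e • e with hk
    by_cases hkk : q.bilin k k = 0
    · refine ⟨E, hE, fun x hx => ?_⟩
      rcases Finset.mem_insert.1 hx with rfl | hx
      · exact hkk
      · exact hs x hx
    have hc : 0 < Real.sqrt (q.bilin k k) :=
      Real.sqrt_pos.2 ((q.nonneg k).lt_of_ne' hkk)
    set c := Real.sqrt (q.bilin k k) with hcdef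
    have hc2 : q.bilin k k = c * c := (Real.mul_self_sqrt (q.nonneg k)).symm
    have hkE : ∀ e ∈ E, q.bilin k e = 0 := fun e he => hE.bilin_residual v he
    set f := c⁻¹ • k with hf
    have hfE : ∀ e ∈ E, q.bilin f e = 0 := fun e he => by
      rw [hf, map_smul, LinearMap.smul_apply, hkE e he, smul_zero]
    have hff : q.bilin f f = 1 := by
      rw [hf, map_smul, map_smul, LinearMap.smul_apply, hc2, smul_eq_mul, smul_eq_mul]
      field_simp
    have hfnot : f ∉ E := fun hmem => by simp [hfE f hmem] at hff
    have hvf : q.bilin v f = c := by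
      have hv : v = k + ∑ e ∈ E, q.bilin v e • e := by rw [hk, sub_add_cancel]
      have hsum : q.bilin (∑ e ∈ E, q.bilin v e • e) f = 0 := by
        rw [q.symm, map_sum]
        exact Finset.sum_eq_zero fun e he => by rw [map_smul, hfE e he, smul_zero]
      rw [hv, map_add, LinearMap.add_apply, hsum, add_zero, hf, map_smul, hc2, smul_eq_mul]
      field_simp
    refine ⟨insert f E, ⟨fun e he => ?_, fun e he g hg heg => ?_⟩, fun x hx => ?_⟩
    · rcases Finset.mem_insert.1 he with rfl | he
      · exact hff
      · exact hE.1 e he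
    · rcases Finset.mem_insert.1 he with rfl | he <;> rcases Finset.mem_insert.1 hg with rfl | hg
      · exact absurd rfl heg
      · exact hfE g hg
      · rw [q.symm]
        exact hfE e he
      · exact hE.2 e he g hg heg
    · rw [Finset.sum_insert hfnot, add_comm, ← sub_sub]
      rcases Finset.mem_insert.1 hx with rfl | hx
      · rw [← hk, hvf, hf, smul_inv_smul₀ hc.ne', sub_self, map_zero]
      · have hx0 := hs x hx
        have hxf : q.bilin x f = 0 := by
          have hr := q.bilin_eq_zero_of_bilin_self_eq_zero hx0 f
          have hsum : q.bilin (∑ e ∈ E, q.bilin x e • e) f = 0 := by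
            rw [q.symm, map_sum]
            exact Finset.sum_eq_zero fun e he => by rw [map_smul, hfE e he, smul_zero]
          rwa [map_sub, LinearMap.sub_apply, hsum, sub_zero] at hr
        rw [hxf, zero_smul, sub_zero]
        exact hx0

lemma toFun_nonneg (p : HilbSeminorm W) (v : W) : 0 ≤ p.toFun v := Real.sqrt_nonneg _

end HilbSeminorm

section Concentration

variable {W : Type*} [AddCommGroup W] [Module ℝ W] {p q : HilbSeminorm W} {ε δ T : ℝ}

/-- A functional vanishing on the residuals of `v` and square-bounded on an orthonormal set is
bounded at `v`. -/
lemma HilbSeminorm.IsONS.abs_le {E : Finset W} (hE : q.IsONS E) {ℓ : W →ₗ[ℝ] ℝ} {r : ℝ}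
    (hr : 0 ≤ r) (hℓ : ∑ e ∈ E, ℓ e ^ 2 ≤ r ^ 2) {v : W}
    (hv : ℓ (v - ∑ e ∈ E, q.bilin v e • e) = 0) : |ℓ v| ≤ r * q.toFun v := by
  have hv' : ℓ v = ∑ e ∈ E, q.bilin v e * ℓ e := by
    rw [map_sub, sub_eq_zero] at hv
    simpa using hv
  refine abs_le_of_sq_le_sq ?_ (mul_nonneg hr (q.toFun_nonneg v))
  calc ℓ v ^ 2 ≤ (∑ e ∈ E, q.bilin v e ^ 2) * ∑ e ∈ E, ℓ e ^ 2 := by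
        rw [hv']
        exact Finset.sum_mul_sq_le_sq_mul_sq _ _ _
    _ ≤ q.bilin v v * r ^ 2 :=
        mul_le_mul (hE.sum_sq_le v) hℓ (Finset.sum_nonneg fun _ _ => sq_nonneg _) (q.nonneg v)
    _ = (r * q.toFun v) ^ 2 := by
        rw [mul_pow, HilbSeminorm.toFun, Real.sq_sqrt (q.nonneg v), mul_comm]

lemma measure_exists_lt_abs_le {X : Type*} [MeasurableSpace X] (ν : Measure X)
    [IsProbabilityMeasure ν] (L : X → W →ₗ[ℝ] ℝ) (hL : ∀ w, Measurable fun x => L x w)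
    (hε : 0 < ε) (hδ : 0 < δ) (hT : 0 ≤ T)
    (hker : ∀ v, q.bilin v v = 0 → p.bilin v v = 0)
    (htr : ∀ E : Finset W, q.IsONS E → ∑ e ∈ E, p.bilin e e ≤ T)
    (h : ∀ w, p.toFun w ≤ δ → ν {x | 1 ≤ |L x w|} ≤ ENNReal.ofReal ε) (s : Finset W) :
    ν {x | ∃ v ∈ s, (δ * Real.sqrt ε)⁻¹ * Real.sqrt T * q.toFun v < |L x v|} ≤
      ENNReal.ofReal (14 * ε) := by
  obtain ⟨E, hE, hs⟩ := q.exists_isONS_bilin_residual_eq_zero s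
  set k : W → W := fun v => v - ∑ e ∈ E, q.bilin v e • e with hk
  set τ : ℕ → ℝ := fun n => δ ^ 2 * ε / (T + 1 / ((n : ℝ) + 1)) with hτ
  have hden (n : ℕ) : 0 < T + 1 / ((n : ℝ) + 1) := by positivity
  have hτ0 (n : ℕ) : 0 < τ n := div_pos (by positivity) (hden n)
  have hτmono : Monotone τ := fun m n hmn => by
    simp only [hτ]
    gcongr
  set B : ℕ → Set X := fun n =>
    {x | 1 ≤ τ n * ∑ e ∈ E, L x e ^ 2 + (n : ℝ) ^ 2 * ∑ v ∈ s, L x (k v) ^ 2} with hB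
  have hBmono : Monotone B := fun m n hmn => by
    refine Set.ofPred_subset_ofPred.2 fun x hx => le_trans hx ?_
    have := hτmono hmn
    gcongr
  have hBle (n : ℕ) : ν (B n) ≤ ENNReal.ofReal (14 * ε) := by
    have hu := measure_one_le_sum_sq_le ν L hL p hε hδ h
      (Sum.elim (fun e : E => Real.sqrt (τ n) • (e : W)) fun v : s => (n : ℝ) • k v)
    have hsq := Real.sq_sqrt (hτ0 n).le
    have hset : {x | 1 ≤ ∑ i, L x (Sum.elim (fun e : E => Real.sqrt (τ n) • (e : W))
        (fun v : s => (n : ℝ) • k v) i) ^ 2} = B n := by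
      ext x
      simp only [hB, Set.mem_ofPred_eq, Fintype.sum_sum_type, Sum.elim_inl, Sum.elim_inr, map_smul,
        smul_eq_mul, mul_pow, hsq, ← Finset.mul_sum]
      rw [Finset.sum_coe_sort E fun e => L x e ^ 2, Finset.sum_coe_sort s fun v => L x (k v) ^ 2]
    rw [hset] at hu
    refine hu.trans (ENNReal.ofReal_le_ofReal ?_)
    have hsum : ∑ i, p.bilin (Sum.elim (fun e : E => Real.sqrt (τ n) • (e : W))
        (fun v : s => (n : ℝ) • k v) i) (Sum.elim (fun e : E => Real.sqrt (τ n) • (e : W))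
        (fun v : s => (n : ℝ) • k v) i) = τ n * ∑ e ∈ E, p.bilin e e := by
      rw [Fintype.sum_sum_type]
      simp only [Sum.elim_inl, Sum.elim_inr, map_smul, LinearMap.smul_apply, smul_eq_mul]
      rw [Finset.sum_eq_zero (s := (Finset.univ : Finset s)) fun v _ => by
        rw [hker (k v) (hs v v.2), mul_zero, mul_zero], add_zero,
        Finset.sum_coe_sort E fun e => Real.sqrt (τ n) * (Real.sqrt (τ n) * p.bilin e e),
        Finset.mul_sum]
      exact Finset.sum_congr rfl fun e _ => by rw [← mul_assoc, Real.mul_self_sqrt (hτ0 n).le]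
    have hbound : τ n * ∑ e ∈ E, p.bilin e e ≤ δ ^ 2 * ε := by
      refine (mul_le_mul_of_nonneg_left ((htr E hE).trans (le_add_of_nonneg_right (by positivity :
        0 ≤ 1 / ((n : ℝ) + 1)))) (hτ0 n).le).trans_eq ?_
      exact div_mul_cancel₀ _ (hden n).ne'
    rw [hsum]
    have : (τ n * ∑ e ∈ E, p.bilin e e) / δ ^ 2 ≤ ε := by
      rw [div_le_iff₀ (by positivity), mul_comm ε]
      exact hbound
    linarith
  calc ν {x | ∃ v ∈ s, (δ * Real.sqrt ε)⁻¹ * Real.sqrt T * q.toFun v < |L x v|}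
      ≤ ν (⋃ n, B n) := by
        refine measure_mono fun x => ?_
        rintro ⟨v, hv, hlt⟩
        by_contra hx
        have hx' (n : ℕ) :
            τ n * ∑ e ∈ E, L x e ^ 2 + (n : ℝ) ^ 2 * ∑ v ∈ s, L x (k v) ^ 2 < 1 := by
          by_contra! hn
          exact hx (Set.mem_iUnion.2 ⟨n, hn⟩)
        have hE0 : 0 ≤ ∑ e ∈ E, L x e ^ 2 := Finset.sum_nonneg fun _ _ => sq_nonneg _
        have hs0 : 0 ≤ ∑ v ∈ s, L x (k v) ^ 2 := Finset.sum_nonneg fun _ _ => sq_nonneg _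
        have hres : L x (k v) = 0 := by
          by_contra hne
          have hpos : 0 < L x (k v) ^ 2 := by positivity
          have hle : L x (k v) ^ 2 ≤ ∑ v ∈ s, L x (k v) ^ 2 :=
            Finset.single_le_sum (f := fun v => L x (k v) ^ 2) (fun _ _ => sq_nonneg _) hv
          obtain ⟨n, hn⟩ := exists_nat_gt (1 / L x (k v) ^ 2)
          rw [div_lt_iff₀ hpos] at hn
          have h1 : (1 : ℝ) ≤ n := by
            rcases Nat.eq_zero_or_pos n with rfl | hn0
            · norm_num at hn
            · exact_mod_cast hn0
          have h2 : (n : ℝ) * L x (k v) ^ 2 ≤ (n : ℝ) ^ 2 * ∑ v ∈ s, L x (k v) ^ 2 :=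
            mul_le_mul (by nlinarith) hle hpos.le (by positivity)
          have h3 := mul_nonneg (hτ0 n).le hE0
          linarith [hx' n]
        have hbd : ∑ e ∈ E, L x e ^ 2 ≤ ((δ * Real.sqrt ε)⁻¹ * Real.sqrt T) ^ 2 := by
          rw [mul_pow, inv_pow, mul_pow, Real.sq_sqrt hε.le, Real.sq_sqrt hT, inv_mul_eq_div,
            le_div_iff₀ (by positivity)]
          refine le_of_forall_pos_lt_add fun η hη => ?_
          obtain ⟨n, hn⟩ := exists_nat_one_div_lt hη
          have h1 : τ n * ∑ e ∈ E, L x e ^ 2 < 1 :=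
            lt_of_le_of_lt (le_add_of_nonneg_right (by positivity)) (hx' n)
          rw [hτ, div_mul_eq_mul_div, div_lt_one (hden n)] at h1
          linarith
        exact absurd (hE.abs_le (by positivity) hbd hres) (not_le.2 hlt)
    _ = ⨆ n, ν (B n) := hBmono.measure_iUnion
    _ ≤ _ := iSup_le hBle

/-- Minlos-type lemma for a Radon probability measure and a continuous family of functionals. -/
lemma ofReal_le_measure_forall_abs_le {X : Type*} [TopologicalSpace X] [MeasurableSpace X]
    [BorelSpace X] (ν : Measure X) (hν : IsRadonMeasure ν)
    [IsProbabilityMeasure ν] (L : X → W →ₗ[ℝ] ℝ) (hL : ∀ w, Continuous fun x => L x w)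
    (hε : 0 < ε) (hδ : 0 < δ) (hT : 0 ≤ T)
    (hker : ∀ v, q.bilin v v = 0 → p.bilin v v = 0)
    (htr : ∀ E : Finset W, q.IsONS E → ∑ e ∈ E, p.bilin e e ≤ T)
    (h : ∀ w, p.toFun w ≤ δ → ν {x | 1 ≤ |L x w|} ≤ ENNReal.ofReal ε) :
    ENNReal.ofReal (1 - 14 * ε) ≤
      ν {x | ∀ v, |L x v| ≤ (δ * Real.sqrt ε)⁻¹ * Real.sqrt T * q.toFun v} := by
  set r := (δ * Real.sqrt ε)⁻¹ * Real.sqrt T with hr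
  set U : W → Set X := fun v => {x | r * q.toFun v < |L x v|} with hU
  have hUo (v : W) : IsOpen (U v) := isOpen_lt continuous_const (hL v).abs
  have hC : {x | ∀ v, |L x v| ≤ r * q.toFun v} = (⋃ v, U v)ᶜ := by
    ext x
    simp [hU]
  have hUm : MeasurableSet (⋃ v, U v) := (isOpen_iUnion hUo).measurableSet
  have hle : ν (⋃ v, U v) ≤ ENNReal.ofReal (14 * ε) := by
    rw [hν.2.measure_eq_iSup hUm]
    refine iSup_le fun K => iSup_le fun hKU => iSup_le fun hK => ?_
    obtain ⟨s, hs⟩ := hK.elim_finite_subcover U hUo hKU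
    refine (measure_mono fun x hx => ?_).trans
      (measure_exists_lt_abs_le ν L (fun w => (hL w).measurable) hε hδ hT hker htr h s)
    simpa only [hU, Set.mem_iUnion, Set.mem_ofPred_eq, exists_prop] using hs hx
  rw [hC, prob_compl_eq_one_sub hUm, ENNReal.ofReal_sub _ (by positivity), ENNReal.ofReal_one]
  exact tsub_le_tsub_left hle 1

end Concentration

/-- Lemma `fundamental-lemma-um`: lower bound for the mass of the
set of characters dominated by `r_ε = (δ√ε)⁻¹ √(tr(p/q)) · q` on `S ∩ V`. -/
theorem statement12 {A : Type*} [CommRing A] [Algebra ℝ A]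
    (V : Submodule ℝ A) (hgen : Algebra.adjoin ℝ (V : Set A) = ⊤)
    (p q : HilbSeminorm ↥V) (htr : p.trace q < ⊤)
    (ε δ : ℝ) (hε : 0 < ε) (hδ : 0 < δ)
    (S : Subalgebra ℝ A) (ν : Measure (Character ↥S))
    (hRadon : IsRadonMeasure ν) [IsProbabilityMeasure ν]
    (h : ∀ w : V, ∀ hw : (w : A) ∈ S, p.toFun w ≤ δ →
      ν {α : Character ↥S | 1 ≤ |α ⟨(w : A), hw⟩|} ≤ ENNReal.ofReal ε) :
    ENNReal.ofReal (1 - 14 * ε) ≤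
      ν {α : Character ↥S | ∀ v : V, ∀ hv : (v : A) ∈ S,
        |α ⟨(v : A), hv⟩| ≤
          (δ * Real.sqrt ε)⁻¹ * Real.sqrt (p.trace q).toReal * q.toFun v} := by
  have hker : ∀ v, q.bilin v v = 0 → p.bilin v v = 0 := by
    by_contra hne
    rw [HilbSeminorm.trace, if_neg hne] at htr
    exact lt_irrefl _ htr
  have hsum : ∀ E : Finset V, q.IsONS E → ∑ e ∈ E, p.bilin e e ≤ (p.trace q).toReal := by
    intro E hE
    rw [← ENNReal.ofReal_le_iff_le_toReal htr.ne, HilbSeminorm.trace, if_pos hker]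
    exact le_iSup₂_of_le E hE le_rfl
  let W : Submodule ℝ V := (Subalgebra.toSubmodule S).comap V.subtype
  have hBorel : BorelSpace (Character ↥S) := ⟨rfl⟩
  have hcont (a : S) : Continuous fun α : Character ↥S => α a :=
    (continuous_apply a).comp continuous_induced_dom
  let L : Character ↥S → W →ₗ[ℝ] ℝ := fun α =>
    { toFun := fun w => α ⟨((w : V) : A), w.2⟩
      map_add' := fun x y => map_add α (⟨((x : V) : A), x.2⟩ : S) ⟨((y : V) : A), y.2⟩
      map_smul' := fun c x => map_smul α c (⟨((x : V) : A), x.2⟩ : S) }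
  let pW : HilbSeminorm W := p.comp W.subtype
  let qW : HilbSeminorm W := q.comp W.subtype
  have key := ofReal_le_measure_forall_abs_le (p := pW) (q := qW)
    ν hRadon L (fun w => hcont ⟨((w : V) : A), w.2⟩) hε hδ (T := (p.trace q).toReal) ENNReal.toReal_nonneg
    (fun v => hker v)
    (fun E hE => by
      have hmap := hsum (E.map (Function.Embedding.subtype _)) ?_
      · rwa [Finset.sum_map] at hmap
      · refine ⟨fun e he => ?_, fun e he f hf hef => ?_⟩
        · obtain ⟨e', he', rfl⟩ := Finset.mem_map.1 he
          exact hE.1 e' he'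
        · obtain ⟨e', he', rfl⟩ := Finset.mem_map.1 he
          obtain ⟨f', hf', rfl⟩ := Finset.mem_map.1 hf
          exact hE.2 e' he' f' hf' fun hne => hef (by rw [hne]))
    (fun w hw => h w w.2 hw)
  exact key.trans (measure_mono fun α hα v hv => hα ⟨v, hv⟩)
end

section
/- Let A be a unital commutative ℝ-algebra generated by a linear subspace V ⊆ A, q a Hilbertian seminorm on V, n ∈ ℕ, and E a finite q-orthonormal subset of V. Then for every ℝ-algebra homomorphism α : A → ℝ satisfying |α(v)| ≤ n q(v) for all v ∈ V, one has ∑_{e∈E} α(e)² ≤ n². -/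
open MeasureTheory
open scoped ENNReal

/-- Pythagoras: `q(∑ cₑ e)² = ∑ cₑ²` for a finite `q`-orthonormal set. -/
theorem HilbSeminorm.IsONS.bilin_sum_smul_self {V : Type*} [AddCommGroup V] [Module ℝ V]
    {q : HilbSeminorm V} {E : Finset V} (hE : q.IsONS E) (c : V → ℝ) :
    q.bilin (∑ e ∈ E, c e • e) (∑ e ∈ E, c e • e) = ∑ e ∈ E, c e ^ 2 := by
  simp only [map_sum, LinearMap.sum_apply, map_smul, LinearMap.smul_apply, smul_eq_mul]
  refine Finset.sum_congr rfl fun e he => ?_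
  rw [Finset.sum_eq_single_of_mem e he]
  · rw [hE.1 e he]
    ring
  · intro f hf hfe
    simp [hE.2 f hf e he hfe]

/-- Bessel's inequality for a linear functional bounded by a multiple of a Hilbertian seminorm. -/
theorem HilbSeminorm.IsONS.sum_sq_le_s14 {V : Type*} [AddCommGroup V] [Module ℝ V]
    {q : HilbSeminorm V} {E : Finset V} (hE : q.IsONS E) (φ : V →ₗ[ℝ] ℝ) {C : ℝ}
    (hφ : ∀ v, |φ v| ≤ C * q.toFun v) : ∑ e ∈ E, φ e ^ 2 ≤ C ^ 2 := by
  have h := hφ (∑ e ∈ E, φ e • e)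
  have hsum : φ (∑ e ∈ E, φ e • e) = ∑ e ∈ E, φ e ^ 2 := by
    simp [map_sum, sq]
  rw [HilbSeminorm.toFun, hE.bilin_sum_smul_self, hsum] at h
  have hS : 0 ≤ ∑ e ∈ E, φ e ^ 2 := Finset.sum_nonneg fun e _ => sq_nonneg _
  generalize ∑ e ∈ E, φ e ^ 2 = S at h hS
  rcases hS.eq_or_lt with rfl | hpos
  · positivity
  · have h2 := pow_le_pow_left₀ (abs_nonneg S) h 2
    rw [sq_abs, mul_pow, Real.sq_sqrt hS, sq S] at h2
    exact le_of_mul_le_mul_right h2 hpos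

/-- Lemma `thm::Sazonov::lem2`: for a character `α` with
`|α(v)| ≤ n q(v)` on `V` and a finite `q`-orthonormal set `E`, `∑_{e∈E} α(e)² ≤ n²`. -/
theorem statement14 {A : Type*} [CommRing A] [Algebra ℝ A]
    (V : Submodule ℝ A) (hgen : Algebra.adjoin ℝ (V : Set A) = ⊤)
    (q : HilbSeminorm ↥V) (n : ℕ)
    (E : Finset ↥V) (hE : q.IsONS E)
    (α : Character A) (hα : ∀ v : V, |α (v : A)| ≤ (n : ℝ) * q.toFun v) :
    ∑ e ∈ E, (α (e : A)) ^ 2 ≤ (n : ℝ) ^ 2 := by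
  exact hE.sum_sq_le_s14 (α.toLinearMap ∘ₗ V.subtype) hα
end

section
/- Let A be a unital commutative ℝ-algebra, q a seminorm on A, and B a subalgebra of A that is dense in A with respect to q. Let sp(q) := {α : A → ℝ ℝ-algebra homomorphism : α is q-continuous}, and let τ^A (respectively τ^B) be the topology on sp(q) of pointwise convergence on A (respectively, of pointwise convergence on B), i.e., the weakest topology making α ↦ α(a) continuous for all a ∈ A (respectively, all a ∈ B). Then the Borel σ-algebras of τ^A and of τ^B on sp(q) coincide. -/
open MeasureTheory
open scoped ENNReal

section Statement18

variable {A : Type*} [CommRing A] [Algebra ℝ A]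

/-- The Gelfand spectrum `sp(q)` of a seminorm `q`: the set of `q`-continuous
characters of `A`. -/
def spectrumSet (q : Seminorm ℝ A) : Set (A →ₐ[ℝ] ℝ) :=
  {α | ∃ C > (0 : ℝ), ∀ a : A, |α a| ≤ C * q a}

/-- The topology `τ^A` on `sp(q)` of pointwise convergence on `A`. -/
def tauFull (q : Seminorm ℝ A) : TopologicalSpace ↥(spectrumSet q) :=
  TopologicalSpace.induced (fun (α : ↥(spectrumSet q)) (a : A) => (α : A →ₐ[ℝ] ℝ) a)
    inferInstance

/-- The topology `τ^B` on `sp(q)` of pointwise convergence on `B`. -/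
def tauSub (q : Seminorm ℝ A) (B : Subalgebra ℝ A) : TopologicalSpace ↥(spectrumSet q) :=
  TopologicalSpace.induced (fun (α : ↥(spectrumSet q)) (b : ↥B) => (α : A →ₐ[ℝ] ℝ) b)
    inferInstance

open scoped Topology

/-- The characters `α` in `sp(q)` satisfying the bound `|α a| ≤ C * q a`. -/
def boundedSpectrum (q : Seminorm ℝ A) (C : ℝ) : Set ↥(spectrumSet q) :=
  {α | ∀ a : A, |(α : A →ₐ[ℝ] ℝ) a| ≤ C * q a}

theorem iUnion_boundedSpectrum (q : Seminorm ℝ A) :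
    ⋃ n : ℕ, boundedSpectrum q n = Set.univ := by
  refine Set.eq_univ_of_forall fun α => ?_
  obtain ⟨C, -, hC⟩ := α.2
  obtain ⟨n, hn⟩ := exists_nat_ge C
  exact Set.mem_iUnion.2
    ⟨n, fun a => (hC a).trans (mul_le_mul_of_nonneg_right hn (apply_nonneg q a))⟩

theorem continuous_tauFull_apply (q : Seminorm ℝ A) (a : A) :
    Continuous[tauFull q, inferInstance]
      (fun α : ↥(spectrumSet q) => (α : A →ₐ[ℝ] ℝ) a) :=
  let := tauFull q
  (continuous_apply a).comp continuous_induced_dom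

theorem continuous_tauSub_apply (q : Seminorm ℝ A) (B : Subalgebra ℝ A) {b : A} (hb : b ∈ B) :
    Continuous[tauSub q B, inferInstance]
      (fun α : ↥(spectrumSet q) => (α : A →ₐ[ℝ] ℝ) b) := by
  let := tauSub q B
  have h : Continuous fun (α : ↥(spectrumSet q)) (b : ↥B) => (α : A →ₐ[ℝ] ℝ) b :=
    continuous_induced_dom
  exact continuous_pi_iff.1 h ⟨b, hb⟩

theorem tauFull_le_tauSub (q : Seminorm ℝ A) (B : Subalgebra ℝ A) :
    tauFull q ≤ tauSub q B := by
  let := tauFull q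
  exact continuous_iff_le_induced.1
    (continuous_pi fun b : ↥B => continuous_tauFull_apply q (b : A))

theorem mem_boundedSpectrum_of_dense {q : Seminorm ℝ A} {B : Subalgebra ℝ A}
    (hdense : ∀ a : A, ∀ ε > (0 : ℝ), ∃ b ∈ B, q (a - b) < ε) {C : ℝ} (hC : 0 ≤ C)
    {α : ↥(spectrumSet q)} (hα : ∀ b ∈ B, |(α : A →ₐ[ℝ] ℝ) b| ≤ C * q b) :
    α ∈ boundedSpectrum q C := by
  intro a
  obtain ⟨D, hD, hαD⟩ := α.2
  refine le_of_forall_pos_le_add fun ε hε => ?_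
  obtain ⟨b, hb, hab⟩ := hdense a (ε / (C + D)) (by positivity)
  have hε' : q (a - b) * (C + D) < ε := (lt_div_iff₀ (by positivity)).1 hab
  have hsplit : |(α : A →ₐ[ℝ] ℝ) a| ≤ |(α : A →ₐ[ℝ] ℝ) (a - b)| + |(α : A →ₐ[ℝ] ℝ) b| := by
    simpa using abs_add_le ((α : A →ₐ[ℝ] ℝ) (a - b)) ((α : A →ₐ[ℝ] ℝ) b)
  have hqb : q b ≤ q a + q (a - b) := by
    simpa using map_sub_le_add q a (a - b)
  nlinarith [hαD (a - b), hα b hb, mul_le_mul_of_nonneg_left hqb hC]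

theorem isClosed_boundedSpectrum {q : Seminorm ℝ A} {B : Subalgebra ℝ A}
    (hdense : ∀ a : A, ∀ ε > (0 : ℝ), ∃ b ∈ B, q (a - b) < ε) {C : ℝ} (hC : 0 ≤ C) :
    IsClosed[tauSub q B] (boundedSpectrum q C) := by
  let := tauSub q B
  have h : boundedSpectrum q C =
      ⋂ b ∈ B, {α : ↥(spectrumSet q) | |(α : A →ₐ[ℝ] ℝ) b| ≤ C * q b} := by
    ext α
    simp only [Set.mem_iInter, Set.mem_ofPred_eq]
    exact ⟨fun hα b _ => hα b, mem_boundedSpectrum_of_dense hdense hC⟩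
  rw [h]
  exact isClosed_biInter fun b hb =>
    isClosed_le (continuous_tauSub_apply q B hb).abs continuous_const

/-- On a set of uniformly bounded characters, evaluation at any element of `A` is continuous for
pointwise convergence on a dense subalgebra, as a uniform limit of such evaluations. -/
theorem continuousOn_tauSub_apply {q : Seminorm ℝ A} {B : Subalgebra ℝ A}
    (hdense : ∀ a : A, ∀ ε > (0 : ℝ), ∃ b ∈ B, q (a - b) < ε) {C : ℝ} (hC : 0 ≤ C) (a : A) :
    letI := tauSub q B
    ContinuousOn (fun α : ↥(spectrumSet q) => (α : A →ₐ[ℝ] ℝ) a) (boundedSpectrum q C) := by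
  let := tauSub q B
  refine continuousOn_of_uniform_approx_of_continuousOn fun u hu => ?_
  obtain ⟨ε, hε, hεu⟩ := Metric.mem_uniformity_dist.1 hu
  obtain ⟨b, hb, hab⟩ := hdense a (ε / (C + 1)) (by positivity)
  have hε' : q (a - b) * (C + 1) < ε := (lt_div_iff₀ (by positivity)).1 hab
  refine ⟨fun α => (α : A →ₐ[ℝ] ℝ) b, (continuous_tauSub_apply q B hb).continuousOn,
    fun α hα => hεu ?_⟩
  rw [Real.dist_eq, ← map_sub]
  nlinarith [hα (a - b), apply_nonneg q (a - b)]

theorem exists_isOpen_tauSub_inter_eq {q : Seminorm ℝ A} {B : Subalgebra ℝ A}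
    (hdense : ∀ a : A, ∀ ε > (0 : ℝ), ∃ b ∈ B, q (a - b) < ε) {C : ℝ} (hC : 0 ≤ C)
    {U : Set ↥(spectrumSet q)} (hU : IsOpen[tauFull q] U) :
    ∃ V, IsOpen[tauSub q B] V ∧ U ∩ boundedSpectrum q C = V ∩ boundedSpectrum q C := by
  let := tauSub q B
  obtain ⟨T, hT, rfl⟩ := isOpen_induced_iff.1 hU
  exact continuousOn_iff'.1
    (continuousOn_pi.2 fun a => continuousOn_tauSub_apply hdense hC a) T hT

/-- equation `(eq-sigma-algebras)`: for a `q`-dense subalgebra `B`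
of `A`, the Borel σ-algebras on `sp(q)` of the topologies of pointwise convergence
on `A` and on `B` coincide. -/
theorem statement18 (q : Seminorm ℝ A) (B : Subalgebra ℝ A)
    (hdense : ∀ a : A, ∀ ε > (0 : ℝ), ∃ b ∈ B, q (a - b) < ε) :
    @borel ↥(spectrumSet q) (tauFull q) = @borel ↥(spectrumSet q) (tauSub q B) := by
  refine le_antisymm (MeasurableSpace.generateFrom_le fun U hU => ?_)
    (borel_anti (tauFull_le_tauSub q B))
  let := tauSub q B
  let : MeasurableSpace ↥(spectrumSet q) := borel ↥(spectrumSet q)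
  have : BorelSpace ↥(spectrumSet q) := ⟨rfl⟩
  change MeasurableSet U
  rw [← Set.inter_univ U, ← iUnion_boundedSpectrum q, Set.inter_iUnion]
  refine MeasurableSet.iUnion fun n => ?_
  obtain ⟨V, hV, hUV⟩ := exists_isOpen_tauSub_inter_eq hdense n.cast_nonneg hU
  rw [hUV]
  exact hV.measurableSet.inter (isClosed_boundedSpectrum hdense n.cast_nonneg).measurableSet

end Statement18
end

section
/- Let A be a unital commutative ℝ-algebra generated by a linear subspace V ⊆ A, and L a normalized linear functional on A with L(∑A²) ⊆ [0,∞) such that there exists a countable complete s_L-orthonormal system {eₙ : n ∈ ℕ} in V. Choose (λₙ)_{n∈ℕ} ⊆ (0,∞) with ∑_{n=1}^∞ λₙ² < ∞, set U := {v ∈ V : ∑_{n=1}^∞ λₙ⁻² L(v eₙ)² < ∞}, define the Hilbertian seminorm q(v) := √(∑_{n=1}^∞ λₙ⁻² L(v eₙ)²) on U, and let J(U) := {⟨W⟩ : W a finite-dimensional linear subspace of U}. If {α ∈ X(A) : α|_U is s_L-continuous} ≠ ∅ and for each S ∈ J(U) there exists a representing Radon measure for L|_S on X(S), then there exists a representing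 Radon measure for L|_{⟨U⟩} with support contained in {α ∈ X(⟨U⟩) : α|_U is q-continuous}. -/
open MeasureTheory
open scoped ENNReal

section

open Filter Topology

/-- A family of measures on a countable product of lines is tight when the second moments of each
coordinate are uniformly bounded. -/
theorem isTightMeasureSet_pi_of_lintegral_sq_le {ι : Type*} [Countable ι]
    {S : Set (Measure (ι → ℝ))} {C : ι → ℝ≥0∞} (hC : ∀ i, C i ≠ ⊤)
    (h : ∀ μ ∈ S, ∀ i, ∫⁻ x, ENNReal.ofReal (x i ^ 2) ∂μ ≤ C i) :
    IsTightMeasureSet S := by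
  rw [isTightMeasureSet_iff_exists_isCompact_measure_compl_le]
  intro ε hε
  obtain ⟨δ, hδ, hsum⟩ := ENNReal.exists_pos_sum_of_countable' hε.ne' ι
  set R : ι → ℝ := fun i => (C i / δ i).toReal + 1 with hR
  have hR1 : ∀ i, 1 ≤ R i := fun i => le_add_of_nonneg_left ENNReal.toReal_nonneg
  refine ⟨Set.univ.pi fun i => Set.Icc (-R i) (R i),
    isCompact_univ_pi fun i => isCompact_Icc, fun μ hμ => ?_⟩
  have hsub : (Set.univ.pi fun i => Set.Icc (-R i) (R i))ᶜ ⊆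
      ⋃ i, {x : ι → ℝ | ENNReal.ofReal (R i) ≤ ENNReal.ofReal (x i ^ 2)} := by
    intro x hx
    by_contra hcon
    refine hx fun i _ => ?_
    simp only [Set.mem_iUnion, Set.mem_ofPred_eq, not_exists, not_le] at hcon
    have h1 := (ENNReal.ofReal_lt_ofReal_iff (by linarith [hR1 i])).1 (hcon i)
    have h2 := hR1 i
    exact abs_le.1 (abs_le_of_sq_le_sq (by nlinarith) (by linarith))
  have hbound : ∀ i, μ {x : ι → ℝ | ENNReal.ofReal (R i) ≤ ENNReal.ofReal (x i ^ 2)} ≤ δ i := by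
    intro i
    have hδtop : δ i ≠ ⊤ := ne_top_of_le_ne_top (hsum.trans_le le_top).ne (ENNReal.le_tsum i)
    have hpos : ENNReal.ofReal (R i) ≠ 0 := by
      simpa using (lt_of_lt_of_le one_pos (hR1 i))
    have hq : C i / δ i ≠ ⊤ := ENNReal.div_ne_top (hC i) (hδ i).ne'
    refine (meas_ge_le_lintegral_div
      ((measurable_pi_apply i).pow_const 2).ennreal_ofReal.aemeasurable hpos
      ENNReal.ofReal_ne_top).trans ?_
    refine (ENNReal.div_le_div_right (h μ hμ i) _).trans ?_
    refine ENNReal.div_le_of_le_mul' ?_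
    have h3 : C i / δ i ≤ ENNReal.ofReal (R i) := by
      rw [← ENNReal.ofReal_toReal hq]
      exact ENNReal.ofReal_le_ofReal (by simp [hR])
    rwa [ENNReal.div_le_iff (hδ i).ne' hδtop] at h3
  calc μ _ ≤ μ (⋃ i, {x : ι → ℝ | ENNReal.ofReal (R i) ≤ ENNReal.ofReal (x i ^ 2)}) :=
        measure_mono hsub
    _ ≤ ∑' i, μ {x : ι → ℝ | ENNReal.ofReal (R i) ≤ ENNReal.ofReal (x i ^ 2)} :=
        measure_iUnion_le _
    _ ≤ ∑' i, δ i := ENNReal.tsum_le_tsum hbound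
    _ ≤ ε := hsum.le

/-- Truncating a function at height `M` changes its integral by at most `b / M`, where `b` bounds
the second moment. -/
theorem abs_integral_truncate_sub_le {X : Type*} [MeasurableSpace X] {m : Measure X}
    [IsFiniteMeasure m] {p : X → ℝ} {b M : ℝ} (hM : 0 < M) (hp : Integrable p m)
    (hp2 : Integrable (fun x => p x ^ 2) m) (hb : ∫ x, p x ^ 2 ∂m ≤ b) :
    |∫ x, max (-M) (min (p x) M) ∂m - ∫ x, p x ∂m| ≤ b / M := by
  have hclip : Integrable (fun x => max (-M) (min (p x) M)) m :=
    (integrable_const _).sup (hp.inf (integrable_const _))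
  rw [← integral_sub hclip hp]
  refine (abs_integral_le_integral_abs).trans ?_
  calc ∫ x, |max (-M) (min (p x) M) - p x| ∂m ≤ ∫ x, p x ^ 2 / M ∂m := by
        refine integral_mono (hclip.sub hp).abs (hp2.div_const _) fun x => ?_
        change |max (-M) (min (p x) M) - p x| ≤ p x ^ 2 / M
        rw [le_div_iff₀ hM]
        rcases le_total (p x) M with h1 | h1
        · rcases le_total (-M) (p x) with h2 | h2
          · rw [min_eq_left h1, max_eq_right h2]; simp; positivity
          · rw [min_eq_left h1, max_eq_left h2, abs_of_nonneg (by linarith)]; nlinarith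
        · rw [min_eq_right h1, max_eq_right (by linarith), abs_of_nonpos (by linarith)]; nlinarith
    _ = (∫ x, p x ^ 2 ∂m) / M := integral_div _ _
    _ ≤ b / M := by gcongr

section WeakLimit

variable {X T : Type*} [TopologicalSpace X] [MeasurableSpace X] [OpensMeasurableSpace X]
  {F : Filter T} {ms : T → ProbabilityMeasure X} {μ : ProbabilityMeasure X}

/-- Integrals of bounded continuous functions pass to weak limits. -/
theorem tendsto_integral_of_abs_le (h : Tendsto ms F (𝓝 μ)) {g : X → ℝ} (hg : Continuous g)
    {C : ℝ} (hC : ∀ x, |g x| ≤ C) :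
    Tendsto (fun t => ∫ x, g x ∂(ms t : Measure X)) F (𝓝 (∫ x, g x ∂(μ : Measure X))) :=
  ProbabilityMeasure.tendsto_iff_forall_integral_tendsto.1 h
    (BoundedContinuousFunction.ofNormedAddCommGroup g hg C hC)

variable [F.NeBot]

/-- Bounds on integrals of nonnegative continuous functions pass to weak limits. -/
theorem integral_le_of_tendsto_probabilityMeasure (h : Tendsto ms F (𝓝 μ)) {g : X → ℝ}
    (hg : Continuous g) (hg0 : ∀ x, 0 ≤ g x) {b : ℝ}
    (hb : ∀ᶠ t in F, Integrable g (ms t : Measure X) ∧ ∫ x, g x ∂(ms t : Measure X) ≤ b) :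
    Integrable g (μ : Measure X) ∧ ∫ x, g x ∂(μ : Measure X) ≤ b := by
  have hcont : ∀ n : ℕ, Continuous fun x => min (g x) (n : ℝ) := fun n => hg.min continuous_const
  have habs : ∀ (n : ℕ) x, |min (g x) (n : ℝ)| ≤ n := fun n x => by
    rw [abs_of_nonneg (le_min (hg0 x) n.cast_nonneg)]; exact min_le_right _ _
  have hint : ∀ (n : ℕ) (m : Measure X) [IsProbabilityMeasure m],
      Integrable (fun x => min (g x) (n : ℝ)) m := fun n m _ =>
    Integrable.of_bound (hcont n).measurable.aestronglyMeasurable n (ae_of_all _ (habs n))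
  have hn : ∀ n : ℕ, ∫ x, min (g x) (n : ℝ) ∂(μ : Measure X) ≤ b := fun n => by
    refine le_of_tendsto (tendsto_integral_of_abs_le h (hcont n) (habs n)) ?_
    filter_upwards [hb] with t ht
    exact (integral_mono (hint n _) ht.1 fun x => min_le_left _ _).trans ht.2
  have hlin : ∫⁻ x, ENNReal.ofReal (g x) ∂(μ : Measure X) ≤ ENNReal.ofReal b := by
    have hpt : ∀ x, Tendsto (fun n : ℕ => ENNReal.ofReal (min (g x) (n : ℝ))) atTop
        (𝓝 (ENNReal.ofReal (g x))) := fun x => by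
      refine tendsto_const_nhds.congr' ?_
      filter_upwards [eventually_ge_atTop ⌈g x⌉₊] with n hn
      rw [min_eq_left ((Nat.le_ceil _).trans (by exact_mod_cast hn))]
    have hle := lintegral_liminf_le (μ := (μ : Measure X)) (u := atTop)
      (f := fun (n : ℕ) x => ENNReal.ofReal (min (g x) (n : ℝ)))
      fun n => (hcont n).measurable.ennreal_ofReal
    simp only [fun x => (hpt x).liminf_eq] at hle
    refine hle.trans (liminf_le_of_le (by isBoundedDefault) fun c hc => ?_)
    obtain ⟨n, hcn⟩ := hc.exists
    refine hcn.trans ?_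
    rw [← ofReal_integral_eq_lintegral_ofReal (hint n _)
      (ae_of_all _ fun x => le_min (hg0 x) n.cast_nonneg)]
    exact ENNReal.ofReal_le_ofReal (hn n)
  have hgi : Integrable g (μ : Measure X) := by
    refine ⟨hg.measurable.aestronglyMeasurable, ?_⟩
    rw [hasFiniteIntegral_iff_ofReal (ae_of_all _ hg0)]
    exact hlin.trans_lt ENNReal.ofReal_lt_top
  have hb0 : 0 ≤ b := by
    obtain ⟨t, ht⟩ := hb.exists
    exact (integral_nonneg hg0).trans ht.2
  refine ⟨hgi, ?_⟩
  rw [← ofReal_integral_eq_lintegral_ofReal hgi (ae_of_all _ hg0)] at hlin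
  exact (ENNReal.ofReal_le_ofReal_iff hb0).1 hlin

/-- Integrals of a continuous function with bounded second moments pass to weak limits. -/
theorem integral_eq_of_tendsto_probabilityMeasure (h : Tendsto ms F (𝓝 μ)) {p : X → ℝ}
    (hp : Continuous p) {a b : ℝ}
    (ha : ∀ᶠ t in F, Integrable p (ms t : Measure X) ∧ ∫ x, p x ∂(ms t : Measure X) = a)
    (hb : ∀ᶠ t in F, Integrable (fun x => p x ^ 2) (ms t : Measure X) ∧
      ∫ x, p x ^ 2 ∂(ms t : Measure X) = b) :
    Integrable p (μ : Measure X) ∧ ∫ x, p x ∂(μ : Measure X) = a := by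
  obtain ⟨hi2, hle2⟩ := integral_le_of_tendsto_probabilityMeasure h (hp.pow 2)
    (fun x => sq_nonneg _) (hb.mono fun t ht => ⟨ht.1, ht.2.le⟩)
  have hi : Integrable p (μ : Measure X) :=
    ((memLp_two_iff_integrable_sq hp.measurable.aestronglyMeasurable).2 hi2).integrable
      one_le_two
  refine ⟨hi, ?_⟩
  have key : ∀ M : ℝ, 0 < M → |∫ x, p x ∂(μ : Measure X) - a| ≤ 2 * b / M := by
    intro M hM
    have h1 := abs_integral_truncate_sub_le hM hi hi2 hle2
    have hclip : Tendsto (fun t => ∫ x, max (-M) (min (p x) M) ∂(ms t : Measure X)) F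
        (𝓝 (∫ x, max (-M) (min (p x) M) ∂(μ : Measure X))) :=
      tendsto_integral_of_abs_le h (by fun_prop) (C := M) fun x =>
        abs_le.2 ⟨le_max_left _ _, max_le (by linarith) (min_le_right _ _)⟩
    have h2 : |∫ x, max (-M) (min (p x) M) ∂(μ : Measure X) - a| ≤ b / M := by
      refine le_of_tendsto (hclip.sub_const a).abs ?_
      filter_upwards [ha, hb] with t hta htb
      have := abs_integral_truncate_sub_le hM hta.1 htb.1 htb.2.le
      rwa [hta.2] at this
    rw [abs_le] at h1 h2 ⊢
    have : 2 * b / M = b / M + b / M := by ring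
    constructor <;> linarith [h1.1, h1.2, h2.1, h2.2]
  have hlim : Tendsto (fun M : ℝ => 2 * b / M) atTop (𝓝 0) :=
    tendsto_const_nhds.div_atTop tendsto_id
  have h0 : |∫ x, p x ∂(μ : Measure X) - a| ≤ 0 :=
    ge_of_tendsto hlim ((eventually_gt_atTop 0).mono key)
  exact sub_eq_zero.1 (abs_nonpos_iff.1 h0)

end WeakLimit

/-- A probability measure that is carried, up to a null set, by an increasing sequence of compact
sets on each of which `f` is continuous has a Radon image under `f`. -/
theorem isRadonMeasure_map_of_continuousOn {X Y : Type*} [TopologicalSpace X] [T2Space X]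
    [MeasurableSpace X] [BorelSpace X] [TopologicalSpace Y] [T2Space Y] [MeasurableSpace Y]
    [BorelSpace Y] {μ : Measure X} [IsProbabilityMeasure μ] [μ.InnerRegularCompactLTTop]
    {D : ℕ → Set X} (hD : ∀ k, IsCompact (D k)) (hmono : Monotone D)
    (hae : ∀ᵐ x ∂μ, x ∈ ⋃ k, D k) {f : X → Y} (hf : ∀ k, ContinuousOn f (D k)) :
    AEMeasurable f μ ∧ IsRadonMeasure (μ.map f) ∧ μ.map f (⋃ k, f '' D k)ᶜ = 0 := by
  have hfm : AEMeasurable f μ := by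
    have h1 : AEMeasurable f (μ.restrict (⋃ k, D k)) :=
      aemeasurable_iUnion_iff.2 fun k => (hf k).aemeasurable (hD k).measurableSet
    rwa [Measure.restrict_eq_self_of_ae_mem hae] at h1
  have hmeas : ∀ B : Set Y, MeasurableSet B → ∀ k, MeasurableSet (f ⁻¹' B ∩ D k) := by
    intro B hB k
    have h1 : MeasurableSet ((D k).domRestrict f ⁻¹' B) := (hf k).domRestrict.measurable hB
    have h2 := (hD k).measurableSet.subtype_image h1
    rwa [Set.domRestrict_eq, Set.preimage_comp, Subtype.image_preimage_coe, Set.inter_comm] at h2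
  have := Measure.isProbabilityMeasure_map hfm
  refine ⟨hfm, ⟨inferInstance, fun B hB r hr => ?_⟩, ?_⟩
  · rw [Measure.map_apply_of_aemeasurable hfm hB] at hr
    have h1 : μ (f ⁻¹' B) = ⨆ k, μ (f ⁻¹' B ∩ D k) := by
      rw [← Monotone.measure_iUnion fun i j hij => Set.inter_subset_inter_right _ (hmono hij),
        ← Set.inter_iUnion]
      refine (measure_congr ?_).symm
      filter_upwards [hae] with x hx
      exact propext ⟨fun h => h.1, fun h => ⟨h, hx⟩⟩
    rw [h1] at hr
    obtain ⟨k, hk⟩ := lt_iSup_iff.1 hr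
    obtain ⟨K, hKsub, hK, hrK⟩ := (hmeas B hB k).exists_lt_isCompact_of_ne_top
      (measure_ne_top _ _) hk
    refine ⟨f '' K, Set.image_subset_iff.2 (hKsub.trans Set.inter_subset_left),
      hK.image_of_continuousOn ((hf k).mono (hKsub.trans Set.inter_subset_right)), ?_⟩
    exact hrK.trans_le ((measure_mono (Set.subset_preimage_image f K)).trans
      (Measure.le_map_apply hfm _))
  · have hms : MeasurableSet (⋃ k, f '' D k)ᶜ :=
      (MeasurableSet.iUnion fun k =>
        ((hD k).image_of_continuousOn (hf k)).measurableSet).compl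
    rw [Measure.map_apply_of_aemeasurable hfm hms]
    refine measure_mono_null (fun x hx => ?_) (ae_iff.1 hae)
    intro hmem
    obtain ⟨k, hk⟩ := Set.mem_iUnion.1 hmem
    exact hx (Set.mem_iUnion.2 ⟨k, x, hk, rfl⟩)

instance (A : Type*) [CommRing A] [Algebra ℝ A] : BorelSpace (Character A) := ⟨rfl⟩

theorem Character.isInducing_coe (A : Type*) [CommRing A] [Algebra ℝ A] :
    IsInducing fun (α : Character A) (a : A) => α a := ⟨rfl⟩

instance (A : Type*) [CommRing A] [Algebra ℝ A] : T2Space (Character A) :=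
  T2Space.of_injective_continuous (f := fun (α : Character A) (a : A) => α a)
    (fun _ _ h => AlgHom.ext (congrFun h)) (Character.isInducing_coe A).continuous

theorem Character.continuous_eval {A : Type*} [CommRing A] [Algebra ℝ A] (a : A) :
    Continuous fun α : Character A => α a :=
  (continuous_apply a).comp (Character.isInducing_coe A).continuous

/-- A function on `U` annihilating all polynomial relations extends to a character of the
algebra generated by `U`. -/
theorem exists_character_of_relations {A : Type*} [CommRing A] [Algebra ℝ A] {U : Set A}
    {c : U → ℝ} (hc : ∀ P : MvPolynomial U ℝ,
      MvPolynomial.aeval (Subtype.val : U → A) P = 0 → MvPolynomial.eval c P = 0) :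
    ∃ φ : Character (Algebra.adjoin ℝ U), ∀ u : U, φ ⟨u, Algebra.subset_adjoin u.2⟩ = c u := by
  set g : MvPolynomial U ℝ →ₐ[ℝ] Algebra.adjoin ℝ U :=
    MvPolynomial.aeval fun u : U => ⟨u, Algebra.subset_adjoin u.2⟩ with hg
  have hcoe : ∀ P, ((g P : Algebra.adjoin ℝ U) : A) =
      MvPolynomial.aeval (Subtype.val : U → A) P := fun P =>
    DFunLike.congr_fun (MvPolynomial.algHom_ext (f := (Algebra.adjoin ℝ U).val.comp g)
      (fun u => by simp [hg])) P
  have hsurj : Function.Surjective g := by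
    rintro ⟨a, ha⟩
    have ha' := ha
    rw [Algebra.adjoin_eq_range] at ha'
    obtain ⟨P, hP⟩ := ha'
    exact ⟨P, Subtype.ext ((hcoe P).trans hP)⟩
  have hker : ∀ P, P ∈ RingHom.ker g → MvPolynomial.aeval c P = (0 : ℝ) := fun P hP => by
    rw [MvPolynomial.aeval_eq_eval]
    exact hc P (by rw [← hcoe, (RingHom.mem_ker).1 hP]; rfl)
  refine ⟨(Ideal.Quotient.liftₐ (RingHom.ker g) (MvPolynomial.aeval c) hker).comp
    (Ideal.quotientKerAlgEquivOfSurjective hsurj).symm.toAlgHom, fun u => ?_⟩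
  have hu : (⟨u, Algebra.subset_adjoin u.2⟩ : Algebra.adjoin ℝ U) =
      Ideal.quotientKerAlgEquivOfSurjective hsurj
        (Ideal.Quotient.mk _ (MvPolynomial.X u)) := by simp [hg]
  rw [hu]
  simp

theorem measurable_mvPolynomial_eval {σ : Type*} (P : MvPolynomial σ ℝ) :
    Measurable fun y : σ → ℝ => MvPolynomial.eval y P := by
  simp only [MvPolynomial.eval_eq]
  fun_prop

/-- The evaluations at the elements of `U` turn a representing measure on the character space of
a subalgebra `S` into a measure on `ℝ^U` with the moments prescribed by `L`. -/
theorem exists_probabilityMeasure_eval {A : Type*} [CommRing A] [Algebra ℝ A] {L : A →ₗ[ℝ] ℝ}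
    (hL1 : L 1 = 1) (hLsq : ∀ a : A, 0 ≤ L (a * a)) (U : Set A) {S : Subalgebra ℝ A}
    {ν : Measure (Character S)} (hν : ∀ a : S, L (a : A) = ∫ α : Character S, α a ∂ν) :
    ∃ m : ProbabilityMeasure (U → ℝ),
      (∀ P : MvPolynomial U ℝ, (∀ u ∈ P.vars, (u : A) ∈ S) →
        Integrable (fun y => MvPolynomial.eval y P) (m : Measure (U → ℝ)) ∧
        ∫ y, MvPolynomial.eval y P ∂(m : Measure (U → ℝ)) =
          L (MvPolynomial.aeval (Subtype.val : U → A) P)) ∧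
      ∀ u : U, ∫⁻ y, ENNReal.ofReal (y u ^ 2) ∂(m : Measure (U → ℝ)) ≤
        ENNReal.ofReal (L (u * u)) := by
  classical
  have hprob : IsProbabilityMeasure ν := by
    have h1 := hν 1
    simp only [OneMemClass.coe_one, hL1, map_one, integral_const, smul_eq_mul, mul_one] at h1
    exact ⟨(ENNReal.toReal_eq_one_iff _).1 h1.symm⟩
  have hint : ∀ a : S, Integrable (fun α : Character S => α a) ν := by
    intro a
    by_contra hna
    have h1 : ¬ Integrable (fun α : Character S => α (a + 1)) ν := fun h => hna <|
      (h.sub (integrable_const (1 : ℝ))).congr (ae_of_all _ fun α => by simp)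
    have h2 := hν a
    have h3 := hν (a + 1)
    rw [integral_undef hna] at h2
    rw [integral_undef h1] at h3
    simp [h2, hL1] at h3
  set Y : U → S := fun u => if h : (u : A) ∈ S then ⟨u, h⟩ else 0 with hY
  set g : Character S → U → ℝ := fun α u => α (Y u) with hg
  have hgm : Measurable g :=
    measurable_pi_lambda _ fun u => (Character.continuous_eval (Y u)).measurable
  have heval : ∀ (P : MvPolynomial U ℝ) (α : Character S),
      MvPolynomial.eval (g α) P = α (MvPolynomial.aeval Y P) := fun P α => by
    rw [← MvPolynomial.aeval_eq_eval]
    exact DFunLike.congr_fun (MvPolynomial.algHom_ext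
      (f := MvPolynomial.aeval (g α)) (g := α.comp (MvPolynomial.aeval Y))
      (fun u => by simp [hg])) P
  have hpm := measurable_mvPolynomial_eval (σ := U)
  refine ⟨⟨ν.map g, Measure.isProbabilityMeasure_map hgm.aemeasurable⟩, fun P hP => ?_,
    fun u => ?_⟩
  · have hval : ((MvPolynomial.aeval Y P : S) : A) =
        MvPolynomial.aeval (Subtype.val : U → A) P := by
      have h1 := DFunLike.congr_fun (MvPolynomial.algHom_ext
        (f := S.val.comp (MvPolynomial.aeval Y))
        (g := MvPolynomial.aeval fun u => (Y u : A)) (fun u => by simp)) P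
      refine h1.trans (MvPolynomial.eval₂Hom_congr' rfl (fun u hu _ => ?_) rfl)
      simp [hY, hP u hu]
    simp only [ProbabilityMeasure.coe_mk]
    rw [integrable_map_measure (hpm P).aestronglyMeasurable hgm.aemeasurable,
      integral_map hgm.aemeasurable (hpm P).aestronglyMeasurable]
    simp only [Function.comp_def, heval]
    exact ⟨hint _, by rw [← hval, hν]⟩
  · simp only [ProbabilityMeasure.coe_mk]
    rw [lintegral_map ((measurable_pi_apply u).pow_const 2).ennreal_ofReal hgm]
    have hsq : ∀ α : Character S, g α u ^ 2 = α (Y u * Y u) := fun α => by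
      simp [hg, sq]
    simp only [hsq]
    rw [← ofReal_integral_eq_lintegral_ofReal (hint _)
      (ae_of_all _ fun α => by simpa using mul_self_nonneg _), ← hν]
    refine ENNReal.ofReal_le_ofReal ?_
    by_cases h : (u : A) ∈ S
    · simp [hY, h]
    · simpa [hY, h] using hLsq u

/-- Along an ultrafilter, the laws of countably many coordinates with bounded second moments
converge. -/
theorem exists_tendsto_map_comp {σ ι T : Type*} [Countable ι] (F : Ultrafilter T)
    {m : T → ProbabilityMeasure (σ → ℝ)} {C : σ → ℝ}
    (hC : ∀ t u, ∫⁻ y, ENNReal.ofReal (y u ^ 2) ∂(m t : Measure (σ → ℝ)) ≤ ENNReal.ofReal (C u))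
    {f : ι → σ} (hf : Measurable fun (y : σ → ℝ) (i : ι) => y (f i)) :
    ∃ μ : ProbabilityMeasure (ι → ℝ),
      Tendsto (fun t => (m t).map hf.aemeasurable) F (𝓝 μ) := by
  have htight : IsTightMeasureSet {((μ : ProbabilityMeasure (ι → ℝ)) : Measure (ι → ℝ)) |
      μ ∈ Set.range fun t => (m t).map hf.aemeasurable} := by
    refine isTightMeasureSet_pi_of_lintegral_sq_le (C := fun i => ENNReal.ofReal (C (f i)))
      (fun i => ENNReal.ofReal_ne_top) ?_
    rintro _ ⟨_, ⟨t, rfl⟩, rfl⟩ i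
    rw [ProbabilityMeasure.toMeasure_map,
      lintegral_map ((measurable_pi_apply i).pow_const 2).ennreal_ofReal hf]
    exact hC t (f i)
  obtain ⟨μ, -, hμ⟩ := (isCompact_closure_of_isTightMeasureSet htight).ultrafilter_le_nhds
    (F.map fun t => (m t).map hf.aemeasurable) (by
      rw [le_principal_iff]
      exact Filter.mem_map.2 (Filter.univ_mem' fun t => subset_closure ⟨t, rfl⟩))
  exact ⟨μ, hμ⟩

/-- From measures with the moments prescribed by `Λ` on finitely many coordinates, one obtains a law
on a fixed sequence of coordinates that extends, for every finite set of further coordinates, to a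
law with the moments prescribed by `Λ`. -/
theorem exists_law_extending {σ : Type*} {Λ : MvPolynomial σ ℝ → ℝ}
    {m : Finset σ → ProbabilityMeasure (σ → ℝ)} {C : σ → ℝ}
    (hm : ∀ (T : Finset σ) (P : MvPolynomial σ ℝ), P.vars ⊆ T →
      Integrable (fun y => MvPolynomial.eval y P) (m T : Measure (σ → ℝ)) ∧
        ∫ y, MvPolynomial.eval y P ∂(m T : Measure (σ → ℝ)) = Λ P)
    (hC : ∀ T u, ∫⁻ y, ENNReal.ofReal (y u ^ 2) ∂(m T : Measure (σ → ℝ)) ≤ ENNReal.ofReal (C u))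
    (s : ℕ → σ) :
    ∃ μ : Measure (ℕ → ℝ), IsProbabilityMeasure μ ∧ ∀ F : Finset σ,
      ∃ μ' : Measure (ℕ ⊕ F → ℝ), IsProbabilityMeasure μ' ∧
        μ'.map (fun z n => z (Sum.inl n)) = μ ∧
        ∀ P : MvPolynomial (ℕ ⊕ F) ℝ, Integrable (fun z => MvPolynomial.eval z P) μ' ∧
          ∫ z, MvPolynomial.eval z P ∂μ' =
            Λ (MvPolynomial.rename (Sum.elim s Subtype.val) P) := by
  classical
  set 𝓕 : Ultrafilter (Finset σ) := Ultrafilter.of atTop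
  have hle : (𝓕 : Filter (Finset σ)) ≤ atTop := Ultrafilter.of_le atTop
  have hs : Measurable fun (y : σ → ℝ) (n : ℕ) => y (s n) :=
    measurable_pi_lambda _ fun n => measurable_pi_apply _
  obtain ⟨μ, hμ⟩ := exists_tendsto_map_comp 𝓕 hC hs
  refine ⟨μ, inferInstance, fun F => ?_⟩
  set f : ℕ ⊕ F → σ := Sum.elim s Subtype.val with hfdef
  have hf : Measurable fun (y : σ → ℝ) (i : ℕ ⊕ F) => y (f i) :=
    measurable_pi_lambda _ fun n => measurable_pi_apply _
  obtain ⟨μ', hμ'⟩ := exists_tendsto_map_comp 𝓕 hC hf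
  refine ⟨μ', inferInstance, ?_, fun P => ?_⟩
  · have hc : Continuous fun (z : ℕ ⊕ F → ℝ) (n : ℕ) => z (Sum.inl n) := by fun_prop
    have h1 := ProbabilityMeasure.tendsto_map_of_tendsto_of_continuous _ _ hμ' hc
    have h2 : (fun T => ((m T).map hf.aemeasurable).map hc.measurable.aemeasurable) =
        fun T => (m T).map hs.aemeasurable := by
      funext T
      refine Subtype.ext ?_
      simp only [ProbabilityMeasure.val_eq_to_measure, ProbabilityMeasure.toMeasure_map]
      rw [Measure.map_map hc.measurable hf]
      rfl
    rw [h2] at h1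
    exact congrArg ProbabilityMeasure.toMeasure (tendsto_nhds_unique h1 hμ)
  · have hmom : ∀ Q : MvPolynomial (ℕ ⊕ F) ℝ, ∀ᶠ T in (𝓕 : Filter (Finset σ)),
        Integrable (fun z => MvPolynomial.eval z Q)
          ((m T).map hf.aemeasurable : Measure (ℕ ⊕ F → ℝ)) ∧
        ∫ z, MvPolynomial.eval z Q ∂((m T).map hf.aemeasurable : Measure (ℕ ⊕ F → ℝ)) =
          Λ (MvPolynomial.rename f Q) := by
      intro Q
      have hQm : Measurable fun z : ℕ ⊕ F → ℝ => MvPolynomial.eval z Q :=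
        measurable_mvPolynomial_eval Q
      filter_upwards [hle (eventually_ge_atTop (MvPolynomial.rename f Q).vars)] with T hT
      have h1 := hm T _ hT
      rw [ProbabilityMeasure.toMeasure_map,
        integrable_map_measure hQm.aestronglyMeasurable hf.aemeasurable,
        integral_map hf.aemeasurable hQm.aestronglyMeasurable]
      simpa only [MvPolynomial.eval_rename, Function.comp_def] using h1
    exact integral_eq_of_tendsto_probabilityMeasure hμ' (MvPolynomial.continuous_eval P)
      (hmom P) (by
        have h := hmom (P ^ 2)
        simp only [map_pow (MvPolynomial.eval _)] at h
        exact h)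

/-- Parseval: the partial sums of the orthonormal expansion of an element in the closure of the
span converge to it in the seminorm induced by `L`. -/
theorem tendsto_sq_sub_sum_orthonormal {A : Type*} [CommRing A] [Algebra ℝ A] {L : A →ₗ[ℝ] ℝ}
    (hLsq : ∀ a : A, 0 ≤ L (a * a)) {e : ℕ → A} (hON1 : ∀ n, L (e n * e n) = 1)
    (hON2 : ∀ m n, m ≠ n → L (e m * e n) = 0) {v : A}
    (hv : ∀ ε > (0 : ℝ), ∃ w ∈ Submodule.span ℝ (Set.range e),
      Real.sqrt (L ((v - w) * (v - w))) < ε) :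
    Tendsto (fun N => L ((v - ∑ n ∈ Finset.range N, L (v * e n) • e n) ^ 2)) atTop (𝓝 0) := by
  set r : ℕ → A := fun N => v - ∑ n ∈ Finset.range N, L (v * e n) • e n with hr
  have hre : ∀ N, ∀ k < N, L (r N * e k) = 0 := by
    intro N k hk
    simp only [hr, sub_mul, Finset.sum_mul, map_sub, map_sum, smul_mul_assoc, map_smul,
      smul_eq_mul]
    rw [Finset.sum_eq_single k (fun n _ hn => by rw [hON2 n k hn, mul_zero])
      (fun h => absurd (Finset.mem_range.2 hk) h), hON1, mul_one, sub_self]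
  have hmin : ∀ w ∈ Submodule.span ℝ (Set.range e), ∀ᶠ N in atTop,
      L (r N ^ 2) ≤ L ((v - w) * (v - w)) := by
    intro w hw
    obtain ⟨a, rfl⟩ := Finsupp.mem_span_range_iff_exists_finsupp.1 hw
    filter_upwards [eventually_gt_atTop (a.support.sup id)] with N hN
    set w := a.sum fun i a => a • e i with hwdef
    have hrw : L (r N * w) = 0 := by
      rw [hwdef, Finsupp.sum, Finset.mul_sum, map_sum]
      refine Finset.sum_eq_zero fun i hi => ?_
      rw [mul_smul_comm, map_smul, hre N i ((Finset.le_sup (f := id) hi).trans_lt hN), smul_zero]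
    have hrs : L (r N * ∑ n ∈ Finset.range N, L (v * e n) • e n) = 0 := by
      rw [Finset.mul_sum, map_sum]
      refine Finset.sum_eq_zero fun i hi => ?_
      rw [mul_smul_comm, map_smul, hre N i (Finset.mem_range.1 hi), smul_zero]
    set d := ∑ n ∈ Finset.range N, L (v * e n) • e n - w with hd
    have hrd : L (r N * d) = 0 := by rw [hd, mul_sub, map_sub, hrs, hrw, sub_zero]
    have hsplit : (v - w) * (v - w) = r N ^ 2 + (r N * d + r N * d) + d * d := by
      simp only [hr, hd]; ring
    rw [hsplit, map_add, map_add, map_add, hrd]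
    linarith [hLsq d]
  have hnn : ∀ N, 0 ≤ L (r N ^ 2) := fun N => by rw [sq]; exact hLsq _
  rw [Metric.tendsto_atTop']
  intro ε hε
  obtain ⟨w, hw, hwε⟩ := hv (Real.sqrt ε) (Real.sqrt_pos.2 hε)
  obtain ⟨N0, hN0⟩ := eventually_atTop.1 (hmin w hw)
  refine ⟨N0, fun N hN => ?_⟩
  rw [Real.dist_eq, sub_zero, abs_of_nonneg (hnn N)]
  exact (hN0 N hN.le).trans_lt ((Real.sqrt_lt_sqrt_iff (hLsq _)).1 hwε)

/-- A function that is an almost sure limit of functions converging in mean square to zero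
vanishes almost surely. -/
theorem ae_eq_zero_of_tendsto_integral_sq {X : Type*} [MeasurableSpace X] {μ : Measure X}
    {f : ℕ → X → ℝ} {g : X → ℝ} (hf : ∀ n, Measurable (f n))
    (hint : ∀ n, Integrable (fun x => f n x ^ 2) μ)
    (h0 : Tendsto (fun n => ∫ x, f n x ^ 2 ∂μ) atTop (𝓝 0))
    (hlim : ∀ᵐ x ∂μ, Tendsto (fun n => f n x) atTop (𝓝 (g x))) :
    ∀ᵐ x ∂μ, g x = 0 := by
  have hlin : Tendsto (fun n => ∫⁻ x, ENNReal.ofReal (f n x ^ 2) ∂μ) atTop (𝓝 0) := by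
    have h1 := (ENNReal.continuous_ofReal.tendsto 0).comp h0
    simp only [ENNReal.ofReal_zero] at h1
    refine h1.congr fun n => ?_
    exact ofReal_integral_eq_lintegral_ofReal (hint n) (ae_of_all _ fun x => sq_nonneg _)
  have hle := lintegral_liminf_le (μ := μ) (u := atTop)
    (f := fun n x => ENNReal.ofReal (f n x ^ 2)) fun n => ((hf n).pow_const 2).ennreal_ofReal
  rw [hlin.liminf_eq] at hle
  have hz := (lintegral_eq_zero_iff
    (.liminf fun n => ((hf n).pow_const 2).ennreal_ofReal)).1 (le_antisymm hle bot_le)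
  filter_upwards [hz, hlim] with x hx hxl
  have h2 : Tendsto (fun n => ENNReal.ofReal (f n x ^ 2)) atTop
      (𝓝 (ENNReal.ofReal (g x ^ 2))) :=
    (ENNReal.continuous_ofReal.tendsto _).comp (hxl.pow 2)
  rw [h2.liminf_eq] at hx
  have h3 := ENNReal.ofReal_eq_zero.1 hx
  exact pow_eq_zero_iff two_ne_zero |>.1 (le_antisymm h3 (sq_nonneg _))

/-- A weighted `ℓ²` sequence pairs summably with a sequence in the dual weighted `ℓ²` space. -/
theorem summable_mul_of_summable_weighted_sq {lam x c : ℕ → ℝ} (hlam : ∀ n, 0 < lam n)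
    (hx : Summable fun n => lam n ^ 2 * x n ^ 2)
    (hc : Summable fun n => (lam n)⁻¹ ^ 2 * c n ^ 2) : Summable fun n => x n * c n := by
  refine Summable.of_norm_bounded (hx.add hc) fun n => ?_
  have h1 : x n * c n = (lam n * x n) * ((lam n)⁻¹ * c n) := by
    have := (hlam n).ne'
    field_simp
  rw [Real.norm_eq_abs, h1, ← mul_pow, ← mul_pow, abs_le]
  constructor <;>
    nlinarith [sq_nonneg (lam n * x n + (lam n)⁻¹ * c n),
      sq_nonneg (lam n * x n - (lam n)⁻¹ * c n), sq_nonneg (lam n * x n),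
      sq_nonneg ((lam n)⁻¹ * c n)]

/-- The law of the coordinates along an orthonormal system is carried by a weighted `ℓ²` space, and
the series expansion of the elements of `U` reproduces all moments of `L`. -/
theorem ae_summable_and_integral_eval_eq {A : Type*} [CommRing A] [Algebra ℝ A]
    {L : A →ₗ[ℝ] ℝ} (hLsq : ∀ a : A, 0 ≤ L (a * a)) {e : ℕ → A}
    (hON1 : ∀ n, L (e n * e n) = 1) (hON2 : ∀ m n, m ≠ n → L (e m * e n) = 0)
    {lam : ℕ → ℝ} (hlam : ∀ n, 0 < lam n) (hsum : Summable fun n => lam n ^ 2) {U : Set A}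
    (hUc : ∀ v ∈ U, ∀ ε > (0 : ℝ), ∃ w ∈ Submodule.span ℝ (Set.range e),
      Real.sqrt (L ((v - w) * (v - w))) < ε)
    (hUs : ∀ v ∈ U, Summable fun n => (lam n)⁻¹ ^ 2 * L (v * e n) ^ 2)
    (heU : ∀ n, e n ∈ U) {μ : Measure (ℕ → ℝ)}
    (hμ : ∀ F : Finset U, ∃ μ' : Measure (ℕ ⊕ F → ℝ), IsProbabilityMeasure μ' ∧
        μ'.map (fun z n => z (Sum.inl n)) = μ ∧
        ∀ P : MvPolynomial (ℕ ⊕ F) ℝ, Integrable (fun z => MvPolynomial.eval z P) μ' ∧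
          ∫ z, MvPolynomial.eval z P ∂μ' = L (MvPolynomial.aeval (Subtype.val : U → A)
            (MvPolynomial.rename (Sum.elim (fun n => ⟨e n, heU n⟩) Subtype.val) P))) :
    (∀ᵐ x ∂μ, Summable fun n => lam n ^ 2 * x n ^ 2) ∧
      ∀ P : MvPolynomial U ℝ,
        Integrable (fun x => MvPolynomial.eval (fun u : U => ∑' n, x n * L (u * e n)) P) μ ∧
        ∫ x, MvPolynomial.eval (fun u : U => ∑' n, x n * L (u * e n)) P ∂μ =
          L (MvPolynomial.aeval (Subtype.val : U → A) P) := by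
  have hproj : ∀ F : Finset U, Measurable fun (z : ℕ ⊕ F → ℝ) (n : ℕ) => z (Sum.inl n) :=
    fun F => measurable_pi_lambda _ fun n => measurable_pi_apply _
  have hae : ∀ᵐ x ∂μ, Summable fun n => lam n ^ 2 * x n ^ 2 := by
    obtain ⟨μ', hμ'p, hmap, hmom⟩ := hμ ∅
    have hsq : ∀ n, ∫⁻ x, ENNReal.ofReal (x n ^ 2) ∂μ = 1 := by
      intro n
      rw [← hmap, lintegral_map ((measurable_pi_apply n).pow_const 2).ennreal_ofReal (hproj ∅)]
      have h1 := hmom (MvPolynomial.X (Sum.inl n) ^ 2)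
      simp only [map_pow, MvPolynomial.eval_X, MvPolynomial.rename_X, Sum.elim_inl,
        MvPolynomial.aeval_X] at h1
      rw [← ofReal_integral_eq_lintegral_ofReal h1.1 (ae_of_all _ fun z => sq_nonneg _), h1.2,
        sq, hON1, ENNReal.ofReal_one]
    have hm : ∀ n, Measurable fun x : ℕ → ℝ => ENNReal.ofReal (lam n ^ 2 * x n ^ 2) := fun n =>
      (((measurable_pi_apply n).pow_const 2).const_mul _).ennreal_ofReal
    have hlt : ∫⁻ x, ∑' n, ENNReal.ofReal (lam n ^ 2 * x n ^ 2) ∂μ ≠ ⊤ := by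
      rw [lintegral_tsum fun n => (hm n).aemeasurable]
      have h2 : ∀ n, ∫⁻ x, ENNReal.ofReal (lam n ^ 2 * x n ^ 2) ∂μ =
          ENNReal.ofReal (lam n ^ 2) := fun n => by
        simp_rw [ENNReal.ofReal_mul (sq_nonneg (lam n))]
        rw [lintegral_const_mul _ ((measurable_pi_apply n).pow_const 2).ennreal_ofReal, hsq,
          mul_one]
      simp_rw [h2]
      rw [← ENNReal.ofReal_tsum_of_nonneg (fun n => sq_nonneg _) hsum]
      exact ENNReal.ofReal_ne_top
    filter_upwards [ae_lt_top (.tsum hm) hlt] with x hx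
    refine (ENNReal.summable_toReal hx.ne).congr fun n => ?_
    exact ENNReal.toReal_ofReal (by positivity)
  refine ⟨hae, fun P => ?_⟩
  obtain ⟨F, Q, rfl⟩ := MvPolynomial.exists_finset_rename P
  obtain ⟨μ', hμ'p, hmap, hmom⟩ := hμ F
  have hser : ∀ x : ℕ → ℝ, (Summable fun n => lam n ^ 2 * x n ^ 2) → ∀ u : U,
      Tendsto (fun N => ∑ n ∈ Finset.range N, x n * L (u * e n)) atTop
        (𝓝 (∑' n, x n * L (u * e n))) := fun x hx u =>
    (summable_mul_of_summable_weighted_sq hlam hx (hUs u u.2)).hasSum.tendsto_sum_nat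
  have hcoord : ∀ᵐ z ∂μ', ∀ j : F,
      ∑' n, z (Sum.inl n) * L ((j : U) * e n) = z (Sum.inr j) := by
    rw [ae_all_iff]
    intro j
    set p : ℕ → MvPolynomial (ℕ ⊕ F) ℝ := fun N => MvPolynomial.X (Sum.inr j) -
      ∑ n ∈ Finset.range N, MvPolynomial.X (Sum.inl n) * MvPolynomial.C (L ((j : U) * e n))
      with hp
    have hpe : ∀ N z, MvPolynomial.eval z (p N) = z (Sum.inr j) -
        ∑ n ∈ Finset.range N, z (Sum.inl n) * L ((j : U) * e n) := fun N z => by simp [hp]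
    have hpL : ∀ N, MvPolynomial.aeval (Subtype.val : U → A)
        (MvPolynomial.rename (Sum.elim (fun n => ⟨e n, heU n⟩) Subtype.val) (p N)) =
        ((j : U) : A) - ∑ n ∈ Finset.range N, L ((j : U) * e n) • e n := fun N => by
      simp [hp, Algebra.smul_def, mul_comm]
    have hz := ae_eq_zero_of_tendsto_integral_sq (μ := μ')
      (f := fun N z => MvPolynomial.eval z (p N))
      (g := fun z => z (Sum.inr j) - ∑' n, z (Sum.inl n) * L ((j : U) * e n))
      (fun N => measurable_mvPolynomial_eval _)
      (fun N => by
        have h1 := (hmom (p N ^ 2)).1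
        simp only [map_pow (MvPolynomial.eval _)] at h1
        exact h1)
      (by
        refine (tendsto_sq_sub_sum_orthonormal hLsq hON1 hON2 (hUc j j.1.2)).congr fun N => ?_
        have h1 := (hmom (p N ^ 2)).2
        simp only [map_pow, hpL] at h1
        exact h1.symm)
      (by
        rw [← hmap] at hae
        filter_upwards [ae_of_ae_map (hproj F).aemeasurable hae] with z hz
        simp only [hpe]
        exact (hser _ hz j).const_sub _)
    filter_upwards [hz] with z hz
    exact (sub_eq_zero.1 hz).symm
  have hmeas : AEStronglyMeasurable (fun x : ℕ → ℝ =>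
      MvPolynomial.eval (fun j : F => ∑' n, x n * L ((j : U) * e n)) Q) μ := by
    refine ((measurable_mvPolynomial_eval Q).comp_aemeasurable
      (aemeasurable_pi_lambda _ fun j => ?_)).aestronglyMeasurable
    refine aemeasurable_of_tendsto_metrizable_ae atTop
      (f := fun N x => ∑ n ∈ Finset.range N, x n * L ((j : U) * e n))
      (fun N => (Finset.measurable_sum _ fun n _ =>
        (measurable_pi_apply n).mul_const _).aemeasurable) ?_
    filter_upwards [hae] with x hx
    exact hser x hx j
  simp only [MvPolynomial.eval_rename, Function.comp_def]
  have hQ := hmom (MvPolynomial.rename Sum.inr Q)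
  have hQe : (fun z : ℕ ⊕ F → ℝ => MvPolynomial.eval z (MvPolynomial.rename Sum.inr Q)) =ᵐ[μ']
      fun z => MvPolynomial.eval (fun j : F => ∑' n, z (Sum.inl n) * L ((j : U) * e n)) Q := by
    filter_upwards [hcoord] with z hz
    rw [MvPolynomial.eval_rename]
    congr 2
    funext j
    exact (hz j).symm
  rw [MvPolynomial.rename_rename, Sum.elim_comp_inr, integral_congr_ae hQe] at hQ
  rw [← hmap] at hmeas ⊢
  rw [integrable_map_measure hmeas (hproj F).aemeasurable,
    integral_map (hproj F).aemeasurable hmeas]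
  exact ⟨hQ.1.congr hQe, hQ.2⟩

/-- Boundedness in a weighted `ℓ²` norm cuts out a compact set of sequences. -/
theorem isCompact_setOf_sum_weighted_sq_le {lam : ℕ → ℝ} (hlam : ∀ n, 0 < lam n) (R : ℝ) :
    IsCompact {x : ℕ → ℝ | ∀ s : Finset ℕ, ∑ n ∈ s, lam n ^ 2 * x n ^ 2 ≤ R} := by
  refine (isCompact_univ_pi fun n => isCompact_Icc
    (a := -Real.sqrt (R / lam n ^ 2)) (b := Real.sqrt (R / lam n ^ 2))).of_isClosed_subset ?_ ?_
  · simp only [Set.ofPred_forall]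
    exact isClosed_iInter fun s => isClosed_le (by fun_prop) continuous_const
  · intro x hx n _
    have h1 : lam n ^ 2 * x n ^ 2 ≤ R := by simpa using hx {n}
    refine abs_le.1 (Real.abs_le_sqrt ?_)
    rw [le_div_iff₀ (pow_pos (hlam n) 2)]
    linarith

/-- Cauchy–Schwarz for the pairing of a weighted `ℓ²` space with its dual. -/
theorem abs_tsum_mul_le_sqrt {lam x c : ℕ → ℝ} (hlam : ∀ n, 0 < lam n) {R : ℝ}
    (hx : ∀ s : Finset ℕ, ∑ n ∈ s, lam n ^ 2 * x n ^ 2 ≤ R)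
    (hc : Summable fun n => (lam n)⁻¹ ^ 2 * c n ^ 2) :
    |∑' n, x n * c n| ≤ Real.sqrt (R * ∑' n, (lam n)⁻¹ ^ 2 * c n ^ 2) := by
  have hR : 0 ≤ R := by simpa using hx ∅
  have hxs : Summable fun n => lam n ^ 2 * x n ^ 2 :=
    summable_of_sum_le (fun n => by positivity) hx
  refine le_of_tendsto (summable_mul_of_summable_weighted_sq hlam hxs hc).hasSum.tendsto_sum_nat.abs
    (.of_forall fun N => Real.abs_le_sqrt ?_)
  have h1 : ∀ n, x n * c n = (lam n * x n) * ((lam n)⁻¹ * c n) := fun n => by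
    have := (hlam n).ne'
    field_simp
  simp_rw [h1]
  refine (Finset.sum_mul_sq_le_sq_mul_sq _ _ _).trans ?_
  simp_rw [mul_pow]
  exact mul_le_mul (hx _) (hc.sum_le_tsum _ fun n _ => by positivity)
    (Finset.sum_nonneg fun n _ => by positivity) hR

/-- The pairing with a sequence in the dual weighted `ℓ²` space is continuous, for the product
topology, on bounded subsets of the weighted `ℓ²` space. -/
theorem continuousOn_tsum_mul {lam c : ℕ → ℝ} (hlam : ∀ n, 0 < lam n) (R : ℝ)
    (hc : Summable fun n => (lam n)⁻¹ ^ 2 * c n ^ 2) :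
    ContinuousOn (fun x : ℕ → ℝ => ∑' n, x n * c n)
      {x | ∀ s : Finset ℕ, ∑ n ∈ s, lam n ^ 2 * x n ^ 2 ≤ R} := by
  have hunif : TendstoUniformlyOn (fun N (x : ℕ → ℝ) => ∑ n ∈ Finset.range N, x n * c n)
      (fun x => ∑' n, x n * c n) atTop
      {x | ∀ s : Finset ℕ, ∑ n ∈ s, lam n ^ 2 * x n ^ 2 ≤ R} := by
    rw [Metric.tendstoUniformlyOn_iff]
    intro ε hε
    have htail : Tendsto (fun N => Real.sqrt (R * ∑' n, (lam (n + N))⁻¹ ^ 2 * c (n + N) ^ 2))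
        atTop (𝓝 0) := by
      have h1 := ((tendsto_sum_nat_add fun n => (lam n)⁻¹ ^ 2 * c n ^ 2).const_mul R).sqrt
      simpa using h1
    filter_upwards [htail.eventually_lt_const hε] with N hN x hx
    have hxs : Summable fun n => lam n ^ 2 * x n ^ 2 :=
      summable_of_sum_le (fun n => by positivity) hx
    rw [Real.dist_eq, ← (summable_mul_of_summable_weighted_sq hlam hxs hc).sum_add_tsum_nat_add N,
      add_sub_cancel_left]
    refine (abs_tsum_mul_le_sqrt (lam := fun n => lam (n + N)) (x := fun n => x (n + N))
      (c := fun n => c (n + N)) (fun n => hlam _) (fun s => ?_)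
      ((summable_nat_add_iff N).2 hc)).trans_lt hN
    simpa using hx (s.map (addRightEmbedding N))
  exact hunif.continuousOn (.of_forall fun N => by fun_prop)

/-- Closed conditions that each hold almost everywhere hold simultaneously almost everywhere. -/
theorem ae_forall_mem_of_isClosed {X ι : Type*} [TopologicalSpace X] [HereditarilyLindelofSpace X]
    [MeasurableSpace X] {μ : Measure X} {C : ι → Set X} (hC : ∀ i, IsClosed (C i))
    (hae : ∀ i, ∀ᵐ x ∂μ, x ∈ C i) : ∀ᵐ x ∂μ, ∀ i, x ∈ C i := by
  obtain ⟨t, ht, h⟩ := eq_closed_inter_countable C hC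
  have h1 : ∀ᵐ x ∂μ, ∀ i ∈ t, x ∈ C i := (ae_ball_iff ht).2 fun i _ => hae i
  filter_upwards [h1] with x hx
  rw [← Set.mem_iInter, ← h]
  exact Set.mem_iInter₂.2 hx

/-- A probability measure on sequences, concentrated on a weighted `ℓ²` space, for which the
pairings with `c u`, `u ∈ U`, have the moments prescribed by `L` induces a representing Radon
measure on the character space of the algebra generated by `U`, concentrated on the characters
dominated by the dual weighted `ℓ²` norm. -/
theorem exists_isRadonMeasure_character {A : Type*} [CommRing A] [Algebra ℝ A] {L : A →ₗ[ℝ] ℝ}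
    {U : Set A} [Nonempty (Character (Algebra.adjoin ℝ U))] {lam : ℕ → ℝ} (hlam : ∀ n, 0 < lam n)
    {c : U → ℕ → ℝ} (hc : ∀ u, Summable fun n => (lam n)⁻¹ ^ 2 * c u n ^ 2)
    {μ : Measure (ℕ → ℝ)} [IsProbabilityMeasure μ]
    (hae : ∀ᵐ x ∂μ, Summable fun n => lam n ^ 2 * x n ^ 2)
    (hmom : ∀ P : MvPolynomial U ℝ,
      Integrable (fun x => MvPolynomial.eval (fun u => ∑' n, x n * c u n) P) μ ∧
      ∫ x, MvPolynomial.eval (fun u => ∑' n, x n * c u n) P ∂μ =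
        L (MvPolynomial.aeval (Subtype.val : U → A) P)) :
    ∃ ν : Measure (Character (Algebra.adjoin ℝ U)), IsRadonMeasure ν ∧
      (∀ a : Algebra.adjoin ℝ U, L a = ∫ α : Character (Algebra.adjoin ℝ U), α a ∂ν) ∧
      ν {α : Character (Algebra.adjoin ℝ U) | ¬ ∃ C > (0 : ℝ), ∀ u : U,
        |α ⟨u, Algebra.subset_adjoin u.2⟩| ≤
          C * Real.sqrt (∑' n, (lam n)⁻¹ ^ 2 * c u n ^ 2)} = 0 := by
  classical
  set ev : (ℕ → ℝ) → U → ℝ := fun x u => ∑' n, x n * c u n with hev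
  set K : ℕ → Set (ℕ → ℝ) := fun k =>
    {x | ∀ s : Finset ℕ, ∑ n ∈ s, lam n ^ 2 * x n ^ 2 ≤ k} with hKdef
  have hK : ∀ k, IsCompact (K k) := fun k => isCompact_setOf_sum_weighted_sq_le hlam k
  have hKmono : Monotone K := fun i j hij x hx s => (hx s).trans (Nat.cast_le.2 hij)
  have hcont : ∀ k (P : MvPolynomial U ℝ),
      ContinuousOn (fun x => MvPolynomial.eval (ev x) P) (K k) := fun k P =>
    (MvPolynomial.continuous_eval P).comp_continuousOn
      (continuousOn_pi.2 fun u => continuousOn_tsum_mul hlam k (hc u))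
  set rel : Set (MvPolynomial U ℝ) :=
    {P | MvPolynomial.aeval (Subtype.val : U → A) P = 0} with hrel
  have hrel0 : ∀ P ∈ rel, ∀ᵐ x ∂μ, MvPolynomial.eval (ev x) P = 0 := by
    intro P hP
    have h1 := hmom (P ^ 2)
    simp only [map_pow, (show MvPolynomial.aeval (Subtype.val : U → A) P = 0 from hP), ne_eq,
      OfNat.ofNat_ne_zero, not_false_eq_true, zero_pow, map_zero] at h1
    filter_upwards [(integral_eq_zero_iff_of_nonneg (fun x => sq_nonneg _) h1.1).1 h1.2] with x hx
    exact pow_eq_zero_iff two_ne_zero |>.1 hx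
  set D : ℕ → Set (ℕ → ℝ) := fun k => K k ∩ ⋂ P : rel, {x | MvPolynomial.eval (ev x) P = 0}
    with hDdef
  have hclosed : ∀ k (P : rel), IsClosed (K k ∩ {x | MvPolynomial.eval (ev x) P = 0}) :=
    fun k P => (hcont k P).preimage_isClosed_of_isClosed (hK k).isClosed isClosed_singleton
  have hD : ∀ k, IsCompact (D k) := by
    intro k
    refine (hK k).of_isClosed_subset ?_ Set.inter_subset_left
    have : Nonempty rel := ⟨⟨0, map_zero _⟩⟩
    simp only [hDdef, Set.inter_iInter]
    exact isClosed_iInter (hclosed k)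
  have hDae : ∀ᵐ x ∂μ, x ∈ ⋃ k, D k := by
    have h1 : ∀ k : ℕ, ∀ᵐ x ∂μ, x ∈ K k → ∀ P : rel,
        x ∈ K k ∩ {x | MvPolynomial.eval (ev x) P = 0} := fun k => by
      rw [← ae_restrict_iff' (hK k).measurableSet]
      refine ae_forall_mem_of_isClosed (hclosed k) fun P => ?_
      rw [ae_restrict_iff' (hK k).measurableSet]
      filter_upwards [hrel0 P P.2] with x hx hxK using ⟨hxK, hx⟩
    filter_upwards [hae, ae_all_iff.2 h1] with x hx hxr
    obtain ⟨k, hk⟩ := exists_nat_ge (∑' n, lam n ^ 2 * x n ^ 2)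
    have hxK : x ∈ K k := fun s => (hx.sum_le_tsum s fun n _ => by positivity).trans hk
    exact Set.mem_iUnion.2 ⟨k, hxK, Set.mem_iInter.2 fun P => (hxr k hxK P).2⟩
  have hex : ∀ x, ∃ φ : Character (Algebra.adjoin ℝ U), x ∈ ⋃ k, D k →
      ∀ u : U, φ ⟨u, Algebra.subset_adjoin u.2⟩ = ev x u := by
    intro x
    by_cases hx : x ∈ ⋃ k, D k
    · obtain ⟨k, -, hk⟩ := Set.mem_iUnion.1 hx
      obtain ⟨φ, hφ⟩ := exists_character_of_relations fun P hP => Set.mem_iInter.1 hk ⟨P, hP⟩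
      exact ⟨φ, fun _ => hφ⟩
    · exact ⟨Classical.arbitrary _, fun h => absurd h hx⟩
  choose Φ hΦ using hex
  have hpoly : ∀ a : Algebra.adjoin ℝ U, ∃ P : MvPolynomial U ℝ,
      MvPolynomial.aeval (Subtype.val : U → A) P = a ∧
      ∀ x ∈ ⋃ k, D k, Φ x a = MvPolynomial.eval (ev x) P := by
    rintro ⟨a, ha⟩
    have ha' := ha
    rw [Algebra.adjoin_eq_range] at ha'
    obtain ⟨P, rfl⟩ := ha'
    refine ⟨P, rfl, fun x hx => ?_⟩
    set g : MvPolynomial U ℝ →ₐ[ℝ] Algebra.adjoin ℝ U :=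
      MvPolynomial.aeval fun u : U => ⟨u, Algebra.subset_adjoin u.2⟩ with hg
    have h1 : (⟨MvPolynomial.aeval (Subtype.val : U → A) P, ha⟩ : Algebra.adjoin ℝ U) = g P :=
      Subtype.ext (DFunLike.congr_fun (MvPolynomial.algHom_ext
        (g := (Algebra.adjoin ℝ U).val.comp g) (fun u => by simp [hg])) P)
    have h2 := DFunLike.congr_fun (MvPolynomial.algHom_ext (f := (Φ x).comp g)
      (g := MvPolynomial.aeval (ev x)) (fun u => by simp [hg, hΦ x hx u])) P
    rw [MvPolynomial.aeval_eq_eval] at h2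
    exact (congrArg (Φ x) h1).trans h2
  have hΦc : ∀ k, ContinuousOn Φ (D k) := by
    intro k
    rw [(Character.isInducing_coe _).continuousOn_iff]
    refine continuousOn_pi.2 fun a => ?_
    obtain ⟨P, -, hP⟩ := hpoly a
    exact ((hcont k P).mono Set.inter_subset_left).congr fun x hx =>
      hP x (Set.mem_iUnion.2 ⟨k, hx⟩)
  obtain ⟨hΦm, hRadon, hnull⟩ := isRadonMeasure_map_of_continuousOn hD
    (fun i j hij => Set.inter_subset_inter_left _ (hKmono hij)) hDae hΦc
  refine ⟨μ.map Φ, hRadon, fun a => ?_, measure_mono_null ?_ hnull⟩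
  · obtain ⟨P, hPa, hP⟩ := hpoly a
    rw [integral_map hΦm (Character.continuous_eval a).measurable.aestronglyMeasurable, ← hPa,
      ← (hmom P).2]
    refine integral_congr_ae ?_
    filter_upwards [hDae] with x hx
    exact (hP x hx).symm
  · rintro _ hα hmem
    obtain ⟨k, x, hx, rfl⟩ := Set.mem_iUnion.1 hmem
    refine hα ⟨Real.sqrt k + 1, by positivity, fun u => ?_⟩
    rw [hΦ x (Set.mem_iUnion.2 ⟨k, hx⟩) u]
    refine (abs_tsum_mul_le_sqrt hlam hx.1 (hc u)).trans ?_
    rw [Real.sqrt_mul (Nat.cast_nonneg k)]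
    gcongr
    linarith

/-- The elements of `V` whose Fourier coefficients lie in a weighted `ℓ²` space form a subspace. -/
theorem exists_submodule_of_summable_weighted_sq {A : Type*} [CommRing A] [Algebra ℝ A]
    (V : Submodule ℝ A) (L : A →ₗ[ℝ] ℝ) (e : ℕ → A) (lam : ℕ → ℝ) :
    ∃ W : Submodule ℝ A,
      (W : Set A) = {a | a ∈ V ∧ Summable fun n => (lam n)⁻¹ ^ 2 * L (a * e n) ^ 2} := by
  refine ⟨{ carrier := {a | a ∈ V ∧ Summable fun n => (lam n)⁻¹ ^ 2 * L (a * e n) ^ 2}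
            add_mem' := ?_
            zero_mem' := ⟨V.zero_mem, by simp⟩
            smul_mem' := ?_ }, rfl⟩
  · rintro a b ⟨ha, ha'⟩ ⟨hb, hb'⟩
    refine ⟨V.add_mem ha hb, Summable.of_nonneg_of_le (fun n => by positivity) (fun n => ?_)
      ((ha'.add hb').mul_left 2)⟩
    rw [add_mul, map_add, ← mul_add, mul_left_comm]
    refine mul_le_mul_of_nonneg_left ?_ (sq_nonneg _)
    linarith [sq_nonneg (L (a * e n) - L (b * e n))]
  · rintro r a ⟨ha, ha'⟩
    refine ⟨V.smul_mem r ha, (ha'.mul_left (r ^ 2)).congr fun n => ?_⟩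
    rw [smul_mul_assoc, map_smul, smul_eq_mul]
    ring

/-- If `L` is representable on every subalgebra generated by a finite-dimensional subspace of `U`,
then finitely many elements of `U` always have a joint law with the moments prescribed by `L`. -/
theorem exists_probabilityMeasure_of_finiteDimensional {A : Type*} [CommRing A] [Algebra ℝ A]
    {L : A →ₗ[ℝ] ℝ} (hL1 : L 1 = 1) (hLsq : ∀ a : A, 0 ≤ L (a * a)) {U : Set A}
    {W : Submodule ℝ A} (hW : (W : Set A) = U)
    (hrep : ∀ S : Subalgebra ℝ A,
      (∃ W : Submodule ℝ A, (W : Set A) ⊆ U ∧ FiniteDimensional ℝ ↥W ∧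
        S = Algebra.adjoin ℝ (W : Set A)) →
      ∃ νS : Measure (Character ↥S), IsRadonMeasure νS ∧
        ∀ a : S, L (a : A) = ∫ α : Character ↥S, α a ∂νS) (T : Finset U) :
    ∃ m : ProbabilityMeasure (U → ℝ),
      (∀ P : MvPolynomial U ℝ, P.vars ⊆ T →
        Integrable (fun y => MvPolynomial.eval y P) (m : Measure (U → ℝ)) ∧
        ∫ y, MvPolynomial.eval y P ∂(m : Measure (U → ℝ)) =
          L (MvPolynomial.aeval (Subtype.val : U → A) P)) ∧
      ∀ u : U, ∫⁻ y, ENNReal.ofReal (y u ^ 2) ∂(m : Measure (U → ℝ)) ≤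
        ENNReal.ofReal (L (u * u)) := by
  have hTW : Submodule.span ℝ (Subtype.val '' (T : Set U)) ≤ W := Submodule.span_le.2 <| by
    rintro _ ⟨u, -, rfl⟩
    rw [hW]
    exact u.2
  obtain ⟨νS, -, hνS⟩ := hrep _ ⟨_, (SetLike.coe_subset_coe.2 hTW).trans hW.subset,
    FiniteDimensional.span_of_finite ℝ (T.finite_toSet.image _), rfl⟩
  obtain ⟨m, hm, hm2⟩ := exists_probabilityMeasure_eval hL1 hLsq U hνS
  exact ⟨m, fun P hP => hm P fun u hu => Algebra.subset_adjoin
    (Submodule.subset_span ⟨u, hP hu, rfl⟩), hm2⟩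

end

/-- Corollary `cor-appl-lemma`: a representing Radon measure for
`L` restricted to the subalgebra generated by `U`, supported on the `q`-continuous
characters, where `U` and `q` are constructed from a complete `s_L`-orthonormal
system in `V`. -/
theorem statement19 {A : Type*} [CommRing A] [Algebra ℝ A]
    (V : Submodule ℝ A) (hgen : Algebra.adjoin ℝ (V : Set A) = ⊤)
    (L : A →ₗ[ℝ] ℝ) (hL1 : L 1 = 1) (hLsq : ∀ a : A, 0 ≤ L (a * a))
    (e : ℕ → A) (heV : ∀ n, e n ∈ V)
    (hON1 : ∀ n, L (e n * e n) = 1)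
    (hON2 : ∀ m n, m ≠ n → L (e m * e n) = 0)
    (hcomplete : ∀ v ∈ V, ∀ ε > (0 : ℝ), ∃ w ∈ Submodule.span ℝ (Set.range e),
      Real.sqrt (L ((v - w) * (v - w))) < ε)
    (lam : ℕ → ℝ) (hlam : ∀ n, 0 < lam n) (hsum : Summable fun n => lam n ^ 2)
    (U : Set A)
    (hU : U = {a : A | a ∈ V ∧ Summable fun n => (lam n)⁻¹ ^ 2 * L (a * e n) ^ 2})
    (qf : A → ℝ)
    (hqf : ∀ a : A, qf a = Real.sqrt (∑' n, (lam n)⁻¹ ^ 2 * L (a * e n) ^ 2))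
    (hne : ∃ α : Character A, ∃ C > (0 : ℝ), ∀ a ∈ U, |α a| ≤ C * Real.sqrt (L (a * a)))
    (hrep : ∀ S : Subalgebra ℝ A,
      (∃ W : Submodule ℝ A, (W : Set A) ⊆ U ∧ FiniteDimensional ℝ ↥W ∧
        S = Algebra.adjoin ℝ (W : Set A)) →
      ∃ νS : Measure (Character ↥S), IsRadonMeasure νS ∧
        ∀ a : S, L (a : A) = ∫ α : Character ↥S, α a ∂νS) :
    ∃ ν : Measure (Character ↥(Algebra.adjoin ℝ U)), IsRadonMeasure ν ∧
      (∀ a : (Algebra.adjoin ℝ U),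
        L (a : A) = ∫ α : Character ↥(Algebra.adjoin ℝ U), α a ∂ν) ∧
      ν {α : Character ↥(Algebra.adjoin ℝ U) |
        ¬ ∃ C > (0 : ℝ), ∀ a : A, ∀ ha : a ∈ U,
          |α ⟨a, Algebra.subset_adjoin ha⟩| ≤ C * qf a} = 0 := by
  obtain ⟨α₀, -⟩ := hne
  have : Nonempty (Character (Algebra.adjoin ℝ U)) := ⟨α₀.comp (Algebra.adjoin ℝ U).val⟩
  have hUV : ∀ a ∈ U, a ∈ V := fun a ha => by rw [hU] at ha; exact ha.1
  have hUs : ∀ a ∈ U, Summable fun n => (lam n)⁻¹ ^ 2 * L (a * e n) ^ 2 := fun a ha => by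
    rw [hU] at ha; exact ha.2
  have heU : ∀ n, e n ∈ U := by
    intro n
    rw [hU]
    refine ⟨heV n, summable_of_ne_finset_zero (s := {n}) fun m hm => ?_⟩
    rw [hON2 n m (by simpa [eq_comm] using hm)]
    ring
  obtain ⟨W, hW⟩ := exists_submodule_of_summable_weighted_sq V L e lam
  rw [← hU] at hW
  choose m hm hm2 using exists_probabilityMeasure_of_finiteDimensional hL1 hLsq hW hrep
  obtain ⟨μ, hμp, hμ⟩ := exists_law_extending
    (Λ := fun P => L (MvPolynomial.aeval (Subtype.val : U → A) P)) (C := fun u => L (u * u))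
    hm hm2 fun n => ⟨e n, heU n⟩
  obtain ⟨hae, hmom⟩ := ae_summable_and_integral_eval_eq hLsq hON1 hON2 hlam hsum
    (fun v hv => hcomplete v (hUV v hv)) hUs heU hμ
  obtain ⟨ν, hν, hLν, hnull⟩ :=
    exists_isRadonMeasure_character (c := fun (u : U) n => L (u * e n)) hlam
      (fun u => hUs u u.2) hae hmom
  refine ⟨ν, hν, hLν, measure_mono_null ?_ hnull⟩
  rintro α hα ⟨C, hC0, hC⟩
  exact hα ⟨C, hC0, fun a ha => by rw [hqf]; exact hC ⟨a, ha⟩⟩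
end
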